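/- arXiv:1509.08362 — 2 statements merged into one kernel-verified Lean document; each statement's English description precedes it below -/
import Mathlib

section
/- Assume (S1)–(S2). Let 1 < s ≤ u < n and J = {s,…,u}, and set α = 1 − δ^{(1−h)/h}·σ−/σ+ ∈ [0,1). For boundary values (x₋, x₊) ∈ X×X, let Φ_{x₋,x₊} denote the probability measure on X^{u−s+1} whose density with respect to ν_0^{⊗(u−s+1)} is proportional to [Π_{j=s}^{u} m(z_{j−1}, z_j)·g_j(z_j)]·m(z_u, x₊), where z_{s−1} := x₋; assume the corresponding normalizing integral is strictly positive for all boundary values. Then: (i) for every x₊ and every pair of left boundary values x₋, z₋ ∈ X there exists a coupling Ψ of Φ_{x₋,x₊} and Φ_{z₋,x₊} such that Ψ({(z, z') : z_i ≠ z'_i}) ≤ α^{⌊(i−(s−1))/h⌋} for every i ∈ J; and (ii) for every x₋ and every pair of right boundary values x₊, z₊ ∈ X there exists a coupling Ψ of Φ_{x₋,x₊} and Φ_{x₋,z₊} such that Ψ({(z, z') : z_i ≠ z'_i}) ≤ α^{⌊((u+1)−i)/h⌋} for every i ∈ J. -/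
open MeasureTheory Finset

/-- Extension of `z : X^{h-1}` (interpreted as states at times `1, …, h-1`) by the boundary
states `x1` at time `0` and `xh1` at times `≥ h`. -/
noncomputable def ext1 {X : Type*} (x1 xh1 : X) {N : ℕ} (z : Fin N → X) (t : ℕ) : X :=
  if ht : 1 ≤ t ∧ t ≤ N then z ⟨t - 1, by omega⟩ else if t = 0 then x1 else xh1

/-- The `h`-step minorisation of assumption (S1):
`∫ ∏_{j=1}^{h} m(x_j, x_{j+1}) ν₀(dx_2) ⋯ ν₀(dx_h) ≥ σ₋` for all `x_1, x_{h+1}`. -/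
def S1minor {X : Type*} [MeasurableSpace X] (ν0 : Measure X) (mker : X → X → ℝ)
    (h : ℕ) (σm : ℝ) : Prop :=
  ∀ x1 xh1 : X, σm ≤
    ∫ z : Fin (h - 1) → X,
      ∏ j ∈ Finset.range h, mker (ext1 x1 xh1 z j) (ext1 x1 xh1 z (j + 1))
      ∂(Measure.pi fun _ => ν0)

/-- Extension of `z : X^{u-s+1}` (interpreted as states at times `s, …, u`) by the boundary
states `xm` at times `< s` and `xp` at times `> u`. -/
noncomputable def extBlock {X : Type*} (s u : ℕ) (xm xp : X) (z : Fin (u - s + 1) → X)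
    (t : ℕ) : X :=
  if ht : s ≤ t ∧ t ≤ u then z ⟨t - s, by omega⟩ else if t < s then xm else xp

/-- Unnormalized density `[Π_{j=s}^{u} m(z_{j-1}, z_j) g_j(z_j)] · m(z_u, x₊)`
(with `z_{s-1} := x₋`) of the block conditional. -/
noncomputable def blockDens {X : Type*} (mker : X → X → ℝ) (g : ℕ → X → ℝ) (s u : ℕ)
    (xm xp : X) (z : Fin (u - s + 1) → X) : ℝ :=
  (∏ j ∈ Finset.Icc s u,
      mker (extBlock s u xm xp z (j - 1)) (extBlock s u xm xp z j) *
        g j (extBlock s u xm xp z j)) *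
    mker (extBlock s u xm xp z u) xp

/-- Normalizing constant of the block conditional. -/
noncomputable def blockZ {X : Type*} [MeasurableSpace X] (ν0 : Measure X)
    (mker : X → X → ℝ) (g : ℕ → X → ℝ) (s u : ℕ) (xm xp : X) : ℝ :=
  ∫ z, blockDens mker g s u xm xp z ∂(Measure.pi fun _ : Fin (u - s + 1) => ν0)

/-- The probability measure `Φ_{x₋,x₊}` on `X^{u-s+1}` whose density with respect to
`ν₀^{⊗(u-s+1)}` is proportional to `blockDens`. -/
noncomputable def blockMeasure {X : Type*} [MeasurableSpace X] (ν0 : Measure X)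
    (mker : X → X → ℝ) (g : ℕ → X → ℝ) (s u : ℕ) (xm xp : X) :
    Measure (Fin (u - s + 1) → X) :=
  (ENNReal.ofReal (blockZ ν0 mker g s u xm xp))⁻¹ •
    ((Measure.pi fun _ : Fin (u - s + 1) => ν0).withDensity
      fun z => ENNReal.ofReal (blockDens mker g s u xm xp z))


open scoped ENNReal
open ProbabilityTheory

section Coupling

variable {Ω : Type*} [MeasurableSpace Ω]

/-- A coupling of the images of two finite measures lifts to a coupling of the measures. -/
theorem exists_coupling_of_coupling_map [StandardBorelSpace Ω] {P P' : Measure Ω}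
    [IsFiniteMeasure P] [IsFiniteMeasure P'] [Nonempty Ω] {T : Ω → Ω} (hT : Measurable T)
    {Θ : Measure (Ω × Ω)} (h1 : Θ.map Prod.fst = P.map T) (h2 : Θ.map Prod.snd = P'.map T) :
    ∃ Ψ : Measure (Ω × Ω), Ψ.map Prod.fst = P ∧ Ψ.map Prod.snd = P' ∧
      Ψ.map (Prod.map T T) = Θ := by
  have hΘ : IsFiniteMeasure Θ := by
    refine ⟨?_⟩
    have := congrArg (fun μ => μ Set.univ) h1
    simp only [Measure.map_apply measurable_fst MeasurableSet.univ,
      Measure.map_apply hT MeasurableSet.univ, Set.preimage_univ] at this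
    rw [this]
    exact measure_lt_top _ _
  set κ := condDistrib id T P with hκ
  set κ' := condDistrib id T P' with hκ'
  have eκ : κ.map T =ᵐ[P.map T] Kernel.id :=
    (condDistrib_comp T aemeasurable_id hT).symm.trans (condDistrib_self T)
  have eκ' : κ'.map T =ᵐ[P'.map T] Kernel.id :=
    (condDistrib_comp T aemeasurable_id hT).symm.trans (condDistrib_self T)
  have mκ : κ ∘ₘ (P.map T) = P := by
    rw [hκ, condDistrib_comp_map hT.aemeasurable aemeasurable_id, Measure.map_id]
  have mκ' : κ' ∘ₘ (P'.map T) = P' := by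
    rw [hκ', condDistrib_comp_map hT.aemeasurable aemeasurable_id, Measure.map_id]
  have key : ∀ A B : Set Ω, MeasurableSet A → MeasurableSet B →
      ((κ ∥ₖ κ') ∘ₘ Θ) (A ×ˢ B) = ∫⁻ q, κ q.1 A * κ' q.2 B ∂Θ := by
    intro A B hA hB
    rw [Measure.bind_apply (hA.prod hB) (Kernel.aemeasurable _)]
    refine lintegral_congr fun q => ?_
    rw [Kernel.parallelComp_apply, Measure.prod_prod]
  refine ⟨(κ ∥ₖ κ') ∘ₘ Θ, ?_, ?_, ?_⟩
  · ext A hA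
    rw [Measure.map_apply measurable_fst hA, ← Set.prod_univ, key A _ hA MeasurableSet.univ]
    simp only [measure_univ, mul_one]
    rw [← lintegral_map (κ.measurable_coe hA) measurable_fst, h1,
      ← Measure.bind_apply hA (Kernel.aemeasurable _), mκ]
  · ext A hA
    rw [Measure.map_apply measurable_snd hA, ← Set.univ_prod, key _ A MeasurableSet.univ hA]
    simp only [measure_univ, one_mul]
    rw [← lintegral_map (κ'.measurable_coe hA) measurable_snd, h2,
      ← Measure.bind_apply hA (Kernel.aemeasurable _), mκ']
  · refine Measure.ext_prod fun {A B} hA hB => ?_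
    rw [Measure.map_apply (hT.prodMap hT) (hA.prod hB)]
    have : Prod.map T T ⁻¹' (A ×ˢ B) = (T ⁻¹' A) ×ˢ (T ⁻¹' B) := rfl
    rw [this, key _ _ (hT hA) (hT hB), ← lintegral_indicator_one (hA.prod hB)]
    rw [← h1] at eκ
    rw [← h2] at eκ'
    refine lintegral_congr_ae ?_
    filter_upwards [ae_of_ae_map measurable_fst.aemeasurable eκ,
      ae_of_ae_map measurable_snd.aemeasurable eκ'] with q hq hq'
    rw [← Measure.map_apply hT hA, ← Measure.map_apply hT hB, ← Kernel.map_apply _ hT,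
      ← Kernel.map_apply _ hT, hq, hq', Kernel.id_apply, Kernel.id_apply,
      Measure.dirac_apply' _ hA, Measure.dirac_apply' _ hB]
    simp only [Set.indicator, Set.mem_prod, Pi.one_apply]
    split_ifs <;> simp_all

theorem exists_coupling_of_measure_univ_eq {P P' : Measure Ω} [IsFiniteMeasure P]
    [IsFiniteMeasure P'] (h : P Set.univ = P' Set.univ) :
    ∃ Ψ : Measure (Ω × Ω), Ψ.map Prod.fst = P ∧ Ψ.map Prod.snd = P' := by
  by_cases h0 : P Set.univ = 0
  · have hP := Measure.measure_univ_eq_zero.1 h0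
    have hP' := Measure.measure_univ_eq_zero.1 (h ▸ h0)
    exact ⟨0, by simp [hP], by simp [hP']⟩
  · refine ⟨(P Set.univ)⁻¹ • P.prod P', ?_, ?_⟩
    · rw [Measure.map_smul, Measure.map_fst_prod, ← h, smul_smul,
        ENNReal.inv_mul_cancel h0 (measure_ne_top _ _), one_smul]
    · rw [Measure.map_smul, Measure.map_snd_prod, smul_smul,
        ENNReal.inv_mul_cancel h0 (measure_ne_top _ _), one_smul]

theorem add_inf_add_le (C D D' : Measure Ω) [IsFiniteMeasure C] :
    (C + D) ⊓ (C + D') ≤ C + D ⊓ D' := by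
  have hC : C ≤ (C + D) ⊓ (C + D') :=
    le_inf (Measure.le_add_right le_rfl) (Measure.le_add_right le_rfl)
  rw [← Measure.sub_add_cancel_of_le hC, add_comm]
  gcongr
  refine le_inf (Measure.sub_le_of_le_add ?_) (Measure.sub_le_of_le_add ?_)
  · rw [add_comm D]; exact inf_le_left
  · rw [add_comm D']; exact inf_le_right

/-- **Goldstein's coupling**: along finitely many successive coarsenings `T k`, one coupling
realises the total variation distance of all the images. -/
theorem exists_coupling_tails [StandardBorelSpace Ω] (n : ℕ) (T : ℕ → Ω → Ω)
    (hT : ∀ k, Measurable (T k)) (hTT : ∀ k l, k ≤ l → T l ∘ T k = T l) (P P' : Measure Ω)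
    [IsFiniteMeasure P] [IsFiniteMeasure P'] (h : P Set.univ = P' Set.univ) :
    ∃ Ψ : Measure (Ω × Ω), Ψ.map Prod.fst = P ∧ Ψ.map Prod.snd = P' ∧
      ∀ k < n, Ψ {q | T k q.1 ≠ T k q.2} + (P.map (T k) ⊓ P'.map (T k)) Set.univ
        ≤ P Set.univ := by
  induction n generalizing T P P' with
  | zero =>
    obtain ⟨Ψ, h1, h2⟩ := exists_coupling_of_measure_univ_eq h
    exact ⟨Ψ, h1, h2, by simp⟩
  | succ n ih =>
    rcases isEmpty_or_nonempty Ω with hΩ | hΩ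
    · refine ⟨0, Subsingleton.elim _ _, Subsingleton.elim _ _, fun k _ => ?_⟩
      simp [Measure.eq_zero_of_isEmpty]
    set C := P.map (T 0) ⊓ P'.map (T 0) with hC
    have hCP : C ≤ P.map (T 0) := inf_le_left
    have hCP' : C ≤ P'.map (T 0) := inf_le_right
    have : IsFiniteMeasure C := isFiniteMeasure_of_le _ hCP
    set D := P.map (T 0) - C with hD
    set D' := P'.map (T 0) - C with hD'
    have eD : C + D = P.map (T 0) := by rw [add_comm, Measure.sub_add_cancel_of_le hCP]
    have eD' : C + D' = P'.map (T 0) := by rw [add_comm, Measure.sub_add_cancel_of_le hCP']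
    have uD : C Set.univ + D Set.univ = P Set.univ := by
      rw [← Measure.add_apply, eD, Measure.map_apply (hT 0) MeasurableSet.univ, Set.preimage_univ]
    have uD' : C Set.univ + D' Set.univ = P Set.univ := by
      rw [← Measure.add_apply, eD', Measure.map_apply (hT 0) MeasurableSet.univ,
        Set.preimage_univ, h]
    have hDD' : D Set.univ = D' Set.univ :=
      (ENNReal.add_right_inj (measure_ne_top C _)).1 (uD.trans uD'.symm)
    obtain ⟨Θ, hΘ1, hΘ2, hΘ⟩ := ih (fun k => T (k + 1)) (fun k => hT _)
      (fun k l hkl => hTT _ _ (by omega)) D D' hDD'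
    have hdiag : Measurable fun x : Ω => (x, x) := by fun_prop
    obtain ⟨Ψ, hΨ1, hΨ2, hΨ⟩ := exists_coupling_of_coupling_map (P := P) (P' := P') (hT 0)
      (Θ := C.map (fun x => (x, x)) + Θ)
      (by rw [Measure.map_add _ _ measurable_fst, Measure.map_map measurable_fst hdiag, hΘ1, ← eD]
          congr 1; exact Measure.map_id)
      (by rw [Measure.map_add _ _ measurable_snd, Measure.map_map measurable_snd hdiag, hΘ2, ← eD']
          congr 1; exact Measure.map_id)
    have hms : ∀ k, MeasurableSet {q : Ω × Ω | T k q.1 ≠ T k q.2} := fun k =>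
      (measurableSet_eq_fun ((hT k).comp measurable_fst) ((hT k).comp measurable_snd)).compl
    have hne : MeasurableSet {q : Ω × Ω | q.1 ≠ q.2} :=
      (measurableSet_eq_fun measurable_fst measurable_snd).compl
    refine ⟨Ψ, hΨ1, hΨ2, fun k hk => ?_⟩
    rcases k with _ | k
    · have e : {q : Ω × Ω | T 0 q.1 ≠ T 0 q.2} = Prod.map (T 0) (T 0) ⁻¹' {q | q.1 ≠ q.2} := rfl
      rw [e, ← Measure.map_apply ((hT 0).prodMap (hT 0)) hne, hΨ, Measure.add_apply,
        Measure.map_apply hdiag hne, ← hC]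
      have hz : (fun x : Ω => (x, x)) ⁻¹' {q | q.1 ≠ q.2} = ∅ := by ext; simp
      rw [hz, measure_empty, zero_add, ← uD, add_comm, ← hΘ1,
        Measure.map_apply measurable_fst MeasurableSet.univ]
      gcongr
      exact Set.subset_univ _
    · have e : {q : Ω × Ω | T (k + 1) q.1 ≠ T (k + 1) q.2}
          = Prod.map (T 0) (T 0) ⁻¹' {q | T (k + 1) q.1 ≠ T (k + 1) q.2} := by
        ext q
        simp only [Set.mem_preimage, Set.mem_ofPred_eq, Prod.map_fst, Prod.map_snd]
        rw [← Function.comp_apply (f := T (k + 1)) (g := T 0) (x := q.1),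
          ← Function.comp_apply (f := T (k + 1)) (g := T 0) (x := q.2), hTT _ _ (Nat.zero_le _)]
      rw [e, ← Measure.map_apply ((hT 0).prodMap (hT 0)) (hms _), hΨ, Measure.add_apply,
        Measure.map_apply hdiag (hms _)]
      have hz : (fun x : Ω => (x, x)) ⁻¹' {q | T (k + 1) q.1 ≠ T (k + 1) q.2} = ∅ := by ext; simp
      rw [hz, measure_empty, zero_add, ← uD]
      have hm : ∀ Q : Measure Ω, Q.map (T (k + 1)) = (Q.map (T 0)).map (T (k + 1)) := fun Q => by
        rw [Measure.map_map (hT _) (hT _), hTT _ _ (Nat.zero_le _)]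
      rw [hm P, hm P', ← eD, ← eD', Measure.map_add _ _ (hT _), Measure.map_add _ _ (hT _)]
      calc _ ≤ Θ {q | T (k + 1) q.1 ≠ T (k + 1) q.2} + (C.map (T (k + 1))
            + D.map (T (k + 1)) ⊓ D'.map (T (k + 1))) Set.univ := by
            gcongr
            exact add_inf_add_le _ _ _
        _ = C Set.univ + (Θ {q | T (k + 1) q.1 ≠ T (k + 1) q.2}
            + (D.map (T (k + 1)) ⊓ D'.map (T (k + 1))) Set.univ) := by
            rw [Measure.add_apply, Measure.map_apply (hT _) MeasurableSet.univ, Set.preimage_univ]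
            ring
        _ ≤ _ := by gcongr; exact hΘ k (by omega)

end Coupling

section Path

variable {X ι : Type*}

/-- The weight of the steps `t → t + 1 → ⋯ → t + n` of a path that is at `y` at time `t` and at
`z (e j)` at times `j > t`, with terminal weight `β`. -/
noncomputable def pathWeight (k : ℕ → X → X → ℝ≥0∞) (β : X → ℝ≥0∞) (e : ℕ → ι) :
    ℕ → ℕ → X → (ι → X) → ℝ≥0∞
  | 0, _, y, _ => β y
  | n + 1, t, y, z => k t y (z (e (t + 1))) * pathWeight k β e n (t + 1) (z (e (t + 1))) z

variable (k : ℕ → X → X → ℝ≥0∞) (β : X → ℝ≥0∞) (e : ℕ → ι)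

theorem pathWeight_update [DecidableEq ι] (n t : ℕ) (y : X) (z : ι → X) (i : ι) (w : X)
    (hi : ∀ j, t < j → j ≤ t + n → e j ≠ i) :
    pathWeight k β e n t y (Function.update z i w) = pathWeight k β e n t y z := by
  induction n generalizing t y with
  | zero => rfl
  | succ n ih =>
    simp only [pathWeight]
    rw [Function.update_of_ne (hi (t + 1) (by omega) (by omega)),
      ih (t + 1) _ fun j h1 h2 => hi j (by omega) (by omega)]

theorem pathWeight_eq_prod (n t : ℕ) (z : ι → X) (p : ℕ → X)
    (hp : ∀ j, 1 ≤ j → j ≤ n → p j = z (e (t + j))) :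
    pathWeight k β e n t (p 0) z
      = (∏ j ∈ Finset.range n, k (t + j) (p j) (p (j + 1))) * β (p n) := by
  induction n generalizing t p with
  | zero => simp [pathWeight]
  | succ n ih =>
    rw [pathWeight, ← hp 1 le_rfl (by omega), ih (t + 1) (fun j => p (j + 1)) fun j h1 h2 => by
      rw [hp (j + 1) (by omega) (by omega)]; congr 2; omega]
    rw [Finset.prod_range_succ', mul_comm _ (k (t + 0) (p 0) (p (0 + 1))), mul_assoc]
    simp only [add_zero, zero_add, add_right_comm t _ 1, ← add_assoc]

variable [MeasurableSpace X] (ν : Measure X)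

/-- The density of `n + 1` steps from time `t` on. -/
noncomputable def stepKernel (t : ℕ) : ℕ → X → X → ℝ≥0∞
  | 0, x, z => k t x z
  | n + 1, x, z => ∫⁻ y, stepKernel t n x y * k (t + n + 1) y z ∂ν

/-- The total weight of the paths with `n` steps that start at `y` at time `t`. -/
noncomputable def pathMass [Fintype ι] (n t : ℕ) (y : X) : ℝ≥0∞ :=
  ∫⁻ z, pathWeight k β e n t y z ∂(Measure.pi fun _ : ι => ν)

variable {k β}

theorem measurable_pathWeight (hk : ∀ t, Measurable (Function.uncurry (k t)))
    (hβ : Measurable β) (n t : ℕ) :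
    Measurable fun p : X × (ι → X) => pathWeight k β e n t p.1 p.2 := by
  induction n generalizing t with
  | zero => exact hβ.comp measurable_fst
  | succ n ih =>
    simp only [pathWeight]
    refine Measurable.mul ?_ ?_
    · exact (hk t).comp (measurable_fst.prodMk ((measurable_pi_apply _).comp measurable_snd))
    · have h : Measurable fun p : X × (ι → X) => (p.2 (e (t + 1)), p.2) := by fun_prop
      exact (ih (t + 1)).comp h

theorem measurable_pathWeight_eval (hk : ∀ t, Measurable (Function.uncurry (k t)))
    (hβ : Measurable β) (n t : ℕ) (i : ι) :
    Measurable fun z : ι → X => pathWeight k β e n t (z i) z := by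
  have h : Measurable fun z : ι → X => (z i, z) := by fun_prop
  exact (measurable_pathWeight e hk hβ n t).comp h

variable [SFinite ν]

theorem measurable_stepKernel (hk : ∀ t, Measurable (Function.uncurry (k t))) (t n : ℕ) :
    Measurable (Function.uncurry (stepKernel k ν t n)) := by
  induction n with
  | zero => exact hk t
  | succ n ih =>
    have : Measurable fun q : (X × X) × X =>
        stepKernel k ν t n q.1.1 q.2 * k (t + n + 1) q.2 q.1.2 :=
      (ih.comp ((measurable_fst.comp measurable_fst).prodMk measurable_snd)).mul
        ((hk _).comp (measurable_snd.prodMk (measurable_snd.comp measurable_fst)))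
    exact this.lintegral_prod_right'

/-- Chapman–Kolmogorov. -/
theorem stepKernel_add (hk : ∀ t, Measurable (Function.uncurry (k t))) (t n m : ℕ) (x z : X) :
    stepKernel k ν t (n + 1 + m) x z
      = ∫⁻ y, stepKernel k ν t n x y * stepKernel k ν (t + n + 1) m y z ∂ν := by
  induction m generalizing z with
  | zero => rfl
  | succ m ih =>
    have hS := measurable_stepKernel ν hk
    rw [← add_assoc, stepKernel]
    simp_rw [ih, stepKernel]
    have h1 : ∀ y, (∫⁻ w, stepKernel k ν t n x w * stepKernel k ν (t + n + 1) m w y ∂ν)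
        * k (t + (n + 1 + m) + 1) y z
        = ∫⁻ w, stepKernel k ν t n x w * stepKernel k ν (t + n + 1) m w y
          * k (t + (n + 1 + m) + 1) y z ∂ν := fun y => by
      refine (lintegral_mul_const _ ?_).symm
      exact ((hS t n).comp measurable_prodMk_left).mul ((hS _ m).comp measurable_prodMk_right)
    have h2 : ∀ w, stepKernel k ν t n x w
        * (∫⁻ y, stepKernel k ν (t + n + 1) m w y * k (t + n + 1 + m + 1) y z ∂ν)
        = ∫⁻ y, stepKernel k ν t n x w * stepKernel k ν (t + n + 1) m w y
          * k (t + (n + 1 + m) + 1) y z ∂ν := fun w => by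
      rw [← lintegral_const_mul]
      · refine lintegral_congr fun y => ?_
        rw [mul_assoc]
        congr 3
        omega
      · exact ((hS _ m).comp measurable_prodMk_left).mul ((hk _).comp measurable_prodMk_right)
    simp_rw [h1, h2]
    refine lintegral_lintegral_swap (Measurable.aemeasurable ?_)
    refine Measurable.mul (Measurable.mul ?_ ?_) ?_
    · exact (hS t n).comp (measurable_const.prodMk measurable_snd)
    · exact (hS _ m).comp (measurable_snd.prodMk measurable_fst)
    · exact (hk _).comp (measurable_fst.prodMk measurable_const)

end Path

section PathIntegral

variable {X ι : Type*} [MeasurableSpace X] [Fintype ι] {k : ℕ → X → X → ℝ≥0∞} {β : X → ℝ≥0∞}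
  (e : ℕ → ι) (ν : Measure X) [IsProbabilityMeasure ν]

theorem lintegral_pi_update [DecidableEq ι] {f : (ι → X) → ℝ≥0∞} (hf : Measurable f) (i : ι) :
    ∫⁻ z, ∫⁻ w, f (Function.update z i w) ∂ν ∂(Measure.pi fun _ : ι => ν)
      = ∫⁻ z, f z ∂(Measure.pi fun _ : ι => ν) := by
  have h : Measurable fun z : ι → X => ∫⁻ w, f (Function.update z i w) ∂ν := by
    have : Measurable fun q : (ι → X) × X => f (Function.update q.1 i q.2) :=
      hf.comp measurable_update'
    exact this.lintegral_prod_right'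
  refine lintegral_eq_of_lmarginal_eq {i} h hf ?_
  funext z
  simp [lmarginal_singleton]

theorem lintegral_eval_mul_pathWeight (hk : ∀ t, Measurable (Function.uncurry (k t)))
    (hβ : Measurable β) {φ : X → ℝ≥0∞} (hφ : Measurable φ) (n t : ℕ)
    (he : ∀ j, t < j → j ≤ t + n → e j ≠ e t) :
    ∫⁻ z, φ (z (e t)) * pathWeight k β e n t (z (e t)) z ∂(Measure.pi fun _ : ι => ν)
      = ∫⁻ y, φ y * pathMass k β e ν n t y ∂ν := by
  classical
  rw [← lintegral_pi_update ν _ (e t)]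
  · simp only [Function.update_self, pathWeight_update k β e n t _ _ (e t) _ he]
    rw [lintegral_lintegral_swap]
    · refine lintegral_congr fun y => ?_
      rw [lintegral_const_mul, pathMass]
      exact (measurable_pathWeight e hk hβ n t).comp measurable_prodMk_left
    · refine Measurable.aemeasurable ?_
      exact (hφ.comp measurable_snd).mul ((measurable_pathWeight e hk hβ n t).comp
        (measurable_snd.prodMk measurable_fst))
  · exact (hφ.comp (measurable_pi_apply _)).mul (measurable_pathWeight_eval e hk hβ n t _)

theorem measurable_pathMass (hk : ∀ t, Measurable (Function.uncurry (k t)))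
    (hβ : Measurable β) (n t : ℕ) : Measurable (pathMass k β e ν n t) :=
  (measurable_pathWeight e hk hβ n t).lintegral_prod_right'

/-- Integrating out the states strictly between times `t` and `t + n + 1`. -/
theorem lintegral_mul_pathWeight [DecidableEq ι] (hk : ∀ t, Measurable (Function.uncurry (k t)))
    (hβ : Measurable β) (n m t : ℕ) (y : X) {F : (ι → X) → ℝ≥0∞} (hF : Measurable F)
    (he : Set.InjOn e (Set.Icc (t + 1) (t + n + 1 + m)))
    (hFe : ∀ j, t < j → j ≤ t + n → ∀ z w, F (Function.update z (e j) w) = F z) :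
    ∫⁻ z, F z * pathWeight k β e (n + 1 + m) t y z ∂(Measure.pi fun _ : ι => ν)
      = ∫⁻ z, F z * (stepKernel k ν t n y (z (e (t + n + 1)))
          * pathWeight k β e m (t + n + 1) (z (e (t + n + 1))) z)
          ∂(Measure.pi fun _ : ι => ν) := by
  induction n generalizing m with
  | zero => simp [zero_add, add_comm 1 m, pathWeight, stepKernel]
  | succ n ih =>
    have hS := measurable_stepKernel ν hk
    rw [show n + 1 + 1 + m = n + 1 + (m + 1) by ring,
      ih (m + 1) (by convert he using 2; ring) fun j h1 h2 => hFe j h1 (by omega)]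
    have hW := measurable_pathWeight_eval e hk hβ m (t + (n + 1) + 1) (e (t + (n + 1) + 1))
    have hne : ∀ j, t + n + 1 < j → j ≤ t + (n + 1) + 1 + m → e j ≠ e (t + n + 1) :=
      fun j h1 h2 h3 => by
        have := he (Set.mem_Icc.2 ⟨by omega, by omega⟩) (Set.mem_Icc.2 ⟨by omega, by omega⟩) h3
        omega
    rw [← lintegral_pi_update ν _ (e (t + n + 1))]
    · refine lintegral_congr fun z => ?_
      simp only [pathWeight, Function.update_self]
      rw [stepKernel, ← lintegral_mul_const, ← lintegral_const_mul]
      · refine lintegral_congr fun w => ?_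
        rw [hFe (t + n + 1) (by omega) (by omega),
          Function.update_of_ne (hne (t + n + 1 + 1) (by omega) (by omega)),
          pathWeight_update k β e m _ _ _ _ _ fun j h1 h2 => hne j (by omega) (by omega)]
        rw [show t + (n + 1) + 1 = t + n + 1 + 1 by ring]
        ring
      · exact (((hS t n).comp measurable_prodMk_left).mul
          ((hk _).comp measurable_prodMk_right)).mul_const _
      · exact ((hS t n).comp measurable_prodMk_left).mul ((hk _).comp measurable_prodMk_right)
    · refine hF.mul (Measurable.mul ?_ ?_)
      · exact (hS t n).comp (measurable_const.prodMk (measurable_pi_apply _))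
      · exact measurable_pathWeight_eval e hk hβ _ _ _

theorem pathMass_eq_lintegral (hk : ∀ t, Measurable (Function.uncurry (k t)))
    (hβ : Measurable β) (n m t : ℕ) (y : X)
    (he : Set.InjOn e (Set.Icc (t + 1) (t + n + 1 + m))) :
    pathMass k β e ν (n + 1 + m) t y
      = ∫⁻ w, stepKernel k ν t n y w * pathMass k β e ν m (t + n + 1) w ∂ν := by
  classical
  have h := lintegral_mul_pathWeight e ν hk hβ n m t y (F := fun _ => 1) measurable_const he
    (fun _ _ _ _ _ => rfl)
  simp only [one_mul] at h
  rw [pathMass, h]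
  refine lintegral_eval_mul_pathWeight e ν hk hβ
    ((measurable_stepKernel ν hk t n).comp measurable_prodMk_left) m (t + n + 1) ?_
  intro j h1 h2 h3
  have := he (Set.mem_Icc.2 ⟨by omega, by omega⟩) (Set.mem_Icc.2 ⟨by omega, by omega⟩) h3
  omega

end PathIntegral

section Doeblin

variable {X : Type*} [MeasurableSpace X]

/-- One Doeblin step: if `Q` is comparable to `γ` with ratio at least `ε`, then the mass missing
from a common minorant contracts by `α = 1 - ε`. -/
theorem exists_common_minorant_step (ν : Measure X) [SFinite ν] {Q : X → X → ℝ≥0∞}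
    (hQ : Measurable (Function.uncurry Q)) {B B' γ : X → ℝ≥0∞} (hBm : Measurable B)
    (hB'm : Measurable B') (hγ : Measurable γ) {r R ε α a : ℝ≥0∞}
    (hB : ∀ y, B y = ∫⁻ z, Q y z * B' z ∂ν) (hr : ∀ y z, r * γ z ≤ Q y z)
    (hR : ∀ y z, Q y z ≤ R * γ z) (hε : ε * R ≤ r) (hr0 : r ≠ 0) (hα : α + ε = 1)
    {l l' c : Measure X} [SFinite l] [SFinite l'] (hc : c ≤ l) (hc' : c ≤ l')
    (hl : ∫⁻ y, B y ∂l = 1) (hl' : ∫⁻ y, B y ∂l' = 1) (ha : 1 ≤ ∫⁻ y, B y ∂c + a) :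
    ∃ f : X → ℝ≥0∞, Measurable f ∧ (∀ z, f z ≤ ∫⁻ y, Q y z ∂l) ∧
      (∀ z, f z ≤ ∫⁻ y, Q y z ∂l') ∧ 1 ≤ ∫⁻ z, f z * B' z ∂ν + α * a := by
  set G := ∫⁻ z, γ z * B' z ∂ν with hG
  have hBR : ∀ y, B y ≤ R * G := fun y => by
    rw [hB, hG, ← lintegral_const_mul _ (by exact hγ.mul hB'm)]
    exact lintegral_mono fun z => by rw [← mul_assoc]; gcongr; exact hR y z
  have hBr : ∀ y, r * G ≤ B y := fun y => by
    rw [hB, hG, ← lintegral_const_mul _ (by exact hγ.mul hB'm)]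
    exact lintegral_mono fun z => by rw [← mul_assoc]; gcongr; exact hr y z
  have hlR : 1 ≤ R * G * l Set.univ := by
    rw [← hl, ← lintegral_const]; exact lintegral_mono hBR
  have hlr : r * G * l Set.univ ≤ 1 := by
    rw [← hl, ← lintegral_const]; exact lintegral_mono hBr
  have hG0 : G ≠ 0 := fun h => by simp [h] at hlR
  have hl0 : l Set.univ ≠ 0 := fun h => by simp [h] at hlR
  have hGt : G ≠ ⊤ := fun h => by
    rw [h, ENNReal.mul_top hr0, ENNReal.top_mul hl0] at hlr
    simp at hlr
  have hlt : l Set.univ ≠ ⊤ := fun h => by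
    rw [h, ENNReal.mul_top (mul_ne_zero hr0 hG0)] at hlr
    simp at hlr
  have : IsFiniteMeasure l := ⟨hlt.lt_top⟩
  have : IsFiniteMeasure c := isFiniteMeasure_of_le l hc
  set m := ∫⁻ y, B y ∂c with hm
  have hm1 : m ≤ 1 := by rw [← hl]; exact lintegral_mono' hc le_rfl
  have hQm : ∀ z, Measurable fun y => Q y z := fun z => hQ.comp measurable_prodMk_right
  have hminor : ∀ y z, B y * (ε * G⁻¹ * γ z) ≤ Q y z := fun y z =>
    calc B y * (ε * G⁻¹ * γ z) ≤ R * G * (ε * G⁻¹ * γ z) := by gcongr; exact hBR y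
      _ = ε * R * γ z * (G * G⁻¹) := by ring
      _ = ε * R * γ z := by rw [ENNReal.mul_inv_cancel hG0 hGt, mul_one]
      _ ≤ r * γ z := by gcongr
      _ ≤ Q y z := hr y z
  have hle : ∀ L : Measure X, c ≤ L → ∫⁻ y, B y ∂L = 1 → ∀ z,
      ∫⁻ y, Q y z ∂c + (1 - m) * (ε * G⁻¹ * γ z) ≤ ∫⁻ y, Q y z ∂L := by
    intro L hcL hL z
    have hsub : c + (L - c) = L := by rw [add_comm, Measure.sub_add_cancel_of_le hcL]
    have hd : 1 - m ≤ ∫⁻ y, B y ∂(L - c) := by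
      rw [tsub_le_iff_left, hm, ← lintegral_add_measure, hsub, hL]
    conv_rhs => rw [← hsub, lintegral_add_measure]
    gcongr
    refine (mul_le_mul_left hd _).trans ?_
    rw [← lintegral_mul_const _ hBm]
    exact lintegral_mono fun y => hminor y z
  have hQc : Measurable fun z => ∫⁻ y, Q y z ∂c := hQ.lintegral_prod_left'
  refine ⟨fun z => ∫⁻ y, Q y z ∂c + (1 - m) * (ε * G⁻¹ * γ z), ?_, hle l hc hl, hle l' hc' hl', ?_⟩
  · exact hQc.add ((hγ.const_mul _).const_mul _)
  · have e1 : ∫⁻ z, (∫⁻ y, Q y z ∂c) * B' z ∂ν = m := by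
      simp_rw [hm, hB, ← lintegral_mul_const _ (hQm _)]
      refine lintegral_lintegral_swap (Measurable.aemeasurable ?_)
      exact (hQ.comp measurable_swap).mul (hB'm.comp measurable_fst)
    have e2 : ∫⁻ z, (1 - m) * (ε * G⁻¹ * γ z) * B' z ∂ν = (1 - m) * ε := by
      have : ∀ z, (1 - m) * (ε * G⁻¹ * γ z) * B' z = (1 - m) * ε * G⁻¹ * (γ z * B' z) :=
        fun z => by ring
      simp_rw [this]
      rw [lintegral_const_mul _ (by exact hγ.mul hB'm), ← hG, mul_assoc,
        ENNReal.inv_mul_cancel hG0 hGt, mul_one]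
    simp_rw [add_mul]
    rw [lintegral_add_left (by exact hQc.mul hB'm), e1, e2]
    calc (1 : ℝ≥0∞) = m + (1 - m) * (ε + α) := by
          rw [add_comm ε, hα, mul_one, add_tsub_cancel_of_le hm1]
      _ = m + (1 - m) * ε + α * (1 - m) := by ring
      _ ≤ _ := by
          gcongr
          exact tsub_le_iff_left.2 ha

variable {ι : Type*} [Fintype ι] {k : ℕ → X → X → ℝ≥0∞} {β : X → ℝ≥0∞}
  (e : ℕ → ι) (ν : Measure X) [IsProbabilityMeasure ν]

/-- Two paths started at `x` and `x'` have states at time `i (p + 1) + p + 1` whose laws share a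
common part of mass at least `1 - α ^ (i + 1)`. -/
theorem exists_common_minorant (hk : ∀ t, Measurable (Function.uncurry (k t)))
    (hβ : Measurable β) {N p : ℕ} (he : Set.InjOn e (Set.Icc 1 N)) {ε α : ℝ≥0∞}
    (hα : α + ε = 1)
    (hQ : ∀ t, t + p + 1 ≤ N → ∃ (γ : X → ℝ≥0∞) (r R : ℝ≥0∞), Measurable γ ∧ ε * R ≤ r ∧ r ≠ 0 ∧
      ∀ y z, r * γ z ≤ stepKernel k ν t p y z ∧ stepKernel k ν t p y z ≤ R * γ z)
    {x x' : X} (hx0 : pathMass k β e ν N 0 x ≠ 0) (hxt : pathMass k β e ν N 0 x ≠ ⊤)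
    (hx0' : pathMass k β e ν N 0 x' ≠ 0) (hxt' : pathMass k β e ν N 0 x' ≠ ⊤)
    (i : ℕ) (hi : i * (p + 1) + p + 1 ≤ N) :
    ∃ f : X → ℝ≥0∞, Measurable f ∧
      (∀ z, f z ≤ (pathMass k β e ν N 0 x)⁻¹ * stepKernel k ν 0 (i * (p + 1) + p) x z) ∧
      (∀ z, f z ≤ (pathMass k β e ν N 0 x')⁻¹ * stepKernel k ν 0 (i * (p + 1) + p) x' z) ∧
      1 ≤ ∫⁻ z, f z * pathMass k β e ν (N - (i * (p + 1) + p + 1)) (i * (p + 1) + p + 1) z ∂ν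
        + α ^ (i + 1) := by
  have hS := measurable_stepKernel ν hk
  have hM := measurable_pathMass e ν hk hβ
  have hB : ∀ t, t + p + 1 ≤ N → ∀ y, pathMass k β e ν (N - t) t y
      = ∫⁻ w, stepKernel k ν t p y w * pathMass k β e ν (N - (t + p + 1)) (t + p + 1) w ∂ν := by
    intro t ht y
    rw [← pathMass_eq_lintegral e ν hk hβ, show p + 1 + (N - (t + p + 1)) = N - t by omega]
    refine he.mono (Set.Icc_subset_Icc (by omega) (by omega))
  induction i with
  | zero =>
    simp only [zero_mul, zero_add] at hi ⊢
    obtain ⟨γ, r, R, hγ, hε, hr0, hrR⟩ := hQ 0 (by omega)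
    obtain ⟨f, hf, h1, h2, h3⟩ := exists_common_minorant_step ν (hS 0 p) (hM (N - 0) 0) (hM _ _) hγ
      (hB 0 (by omega)) (fun y z => (hrR y z).1) (fun y z => (hrR y z).2) hε hr0 hα (a := 1)
      (l := (pathMass k β e ν N 0 x)⁻¹ • Measure.dirac x)
      (l' := (pathMass k β e ν N 0 x')⁻¹ • Measure.dirac x') (c := 0)
      (Measure.zero_le _) (Measure.zero_le _)
      (by rw [lintegral_smul_measure, lintegral_dirac' _ (hM _ _)]
          exact ENNReal.inv_mul_cancel hx0 hxt)
      (by rw [lintegral_smul_measure, lintegral_dirac' _ (hM _ _)]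
          exact ENNReal.inv_mul_cancel hx0' hxt') (by simp)
    refine ⟨f, hf, fun z => (h1 z).trans_eq ?_, fun z => (h2 z).trans_eq ?_, ?_⟩
    · rw [lintegral_smul_measure,
        lintegral_dirac' _ (by exact (hS 0 p).comp measurable_prodMk_right)]
      rfl
    · rw [lintegral_smul_measure,
        lintegral_dirac' _ (by exact (hS 0 p).comp measurable_prodMk_right)]
      rfl
    · simpa using h3
  | succ i ih =>
    obtain ⟨g, hg, hgx, hgx', hgm⟩ := ih (by rw [add_one_mul] at hi; omega)
    have hn : (i + 1) * (p + 1) + p = i * (p + 1) + p + 1 + p := by ring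
    rw [hn] at hi ⊢
    set n := i * (p + 1) + p with hnd
    obtain ⟨γ, r, R, hγ, hε, hr0, hrR⟩ := hQ (n + 1) hi
    have hSx : ∀ x, Measurable (stepKernel k ν 0 n x) := fun x =>
      (hS 0 n).comp measurable_prodMk_left
    have hone : ∀ x, pathMass k β e ν N 0 x ≠ 0 → pathMass k β e ν N 0 x ≠ ⊤ →
        ∫⁻ y, pathMass k β e ν (N - (n + 1)) (n + 1) y
          ∂(ν.withDensity fun z => (pathMass k β e ν N 0 x)⁻¹ * stepKernel k ν 0 n x z) = 1 := by
      intro x h0 ht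
      rw [lintegral_withDensity_eq_lintegral_mul _ ((hSx x).const_mul _) (hM _ _)]
      simp only [Pi.mul_apply, mul_assoc]
      rw [lintegral_const_mul _ (by exact (hSx x).mul (hM _ _))]
      have := pathMass_eq_lintegral e ν hk hβ n (N - (n + 1)) 0 x
        (he.mono (Set.Icc_subset_Icc (by omega) (by omega)))
      rw [show n + 1 + (N - (n + 1)) = N by omega, zero_add] at this
      rw [← this, ENNReal.inv_mul_cancel h0 ht]
    have hle : ∀ x, (∀ z, g z ≤ (pathMass k β e ν N 0 x)⁻¹ * stepKernel k ν 0 n x z) →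
        ν.withDensity g
          ≤ ν.withDensity fun z => (pathMass k β e ν N 0 x)⁻¹ * stepKernel k ν 0 n x z :=
      fun x h => withDensity_mono (ae_of_all _ h)
    have hCK : ∀ x z, ∫⁻ y, stepKernel k ν (n + 1) p y z
        ∂(ν.withDensity fun z => (pathMass k β e ν N 0 x)⁻¹ * stepKernel k ν 0 n x z)
        = (pathMass k β e ν N 0 x)⁻¹ * stepKernel k ν 0 (n + 1 + p) x z := by
      intro x z
      have hSz : Measurable fun y => stepKernel k ν (n + 1) p y z :=
        (hS (n + 1) p).comp measurable_prodMk_right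
      rw [lintegral_withDensity_eq_lintegral_mul _ ((hSx x).const_mul _) hSz]
      simp only [Pi.mul_apply, mul_assoc]
      rw [lintegral_const_mul _ (by exact (hSx x).mul hSz), stepKernel_add ν hk, zero_add]
    obtain ⟨f, hf, h1, h2, h3⟩ := exists_common_minorant_step ν (hS (n + 1) p)
      (hM (N - (n + 1)) (n + 1)) (hM _ _) hγ (hB (n + 1) hi) (fun y z => (hrR y z).1)
      (fun y z => (hrR y z).2) hε hr0 hα (a := α ^ (i + 1)) (hle x hgx) (hle x' hgx')
      (hone x hx0 hxt) (hone x' hx0' hxt')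
      (by rw [lintegral_withDensity_eq_lintegral_mul _ hg (hM _ _)]; exact hgm)
    refine ⟨f, hf, fun z => (h1 z).trans_eq (hCK x z), fun z => (h2 z).trans_eq (hCK x' z), ?_⟩
    rw [pow_succ' α (i + 1)]
    exact h3

end Doeblin

section Forget

variable {X ι : Type*} (e : ℕ → ι)

/-- Replaces by `x₀` the states of a path at the times `1, …, t - 1`. -/
noncomputable def forgetBefore (x₀ : X) (t : ℕ) (z : ι → X) (i : ι) : X :=
  open Classical in if ∃ j, 1 ≤ j ∧ j < t ∧ e j = i then x₀ else z i

theorem forgetBefore_comp (x₀ : X) {s t : ℕ} (hst : s ≤ t) :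
    forgetBefore e x₀ t ∘ forgetBefore e x₀ s = forgetBefore e x₀ t := by
  funext z i
  simp only [Function.comp_apply, forgetBefore]
  split_ifs with h1 h2
  · rfl
  · obtain ⟨j, hj, hjs, hji⟩ := h2
    exact absurd ⟨j, hj, by omega, hji⟩ h1
  · rfl

theorem forgetBefore_update [DecidableEq ι] (x₀ : X) {t j : ℕ} (h1 : 1 ≤ j) (hj : j < t)
    (z : ι → X) (w : X) :
    forgetBefore e x₀ t (Function.update z (e j) w) = forgetBefore e x₀ t z := by
  funext i
  simp only [forgetBefore]
  split_ifs with h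
  · rfl
  · rw [Function.update_of_ne]
    rintro rfl
    exact h ⟨j, h1, hj, rfl⟩

theorem forgetBefore_apply (x₀ : X) {N t j : ℕ} (he : Set.InjOn e (Set.Icc 1 N)) (h1 : 1 ≤ j)
    (hjN : j ≤ N) (htj : t ≤ j) (z : ι → X) : forgetBefore e x₀ t z (e j) = z (e j) := by
  refine if_neg ?_
  rintro ⟨l, hl, hlt, hlj⟩
  have := he (Set.mem_Icc.2 ⟨hl, by omega⟩) (Set.mem_Icc.2 ⟨h1, hjN⟩) hlj
  omega

theorem measurable_forgetBefore [MeasurableSpace X] (x₀ : X) (t : ℕ) :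
    Measurable (forgetBefore e x₀ t) := by
  refine measurable_pi_lambda _ fun i => ?_
  unfold forgetBefore
  split_ifs
  · exact measurable_const
  · exact measurable_pi_apply i

end Forget

section PathCoupling

variable {X ι : Type*} [MeasurableSpace X] [Fintype ι] {k : ℕ → X → X → ℝ≥0∞} {β : X → ℝ≥0∞}
  (e : ℕ → ι) (ν : Measure X)

/-- The law of a path with `N` steps started at `x`. -/
noncomputable def pathLaw (k : ℕ → X → X → ℝ≥0∞) (β : X → ℝ≥0∞) (N : ℕ) (x : X) :
    Measure (ι → X) :=
  (pathMass k β e ν N 0 x)⁻¹ •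
    (Measure.pi fun _ : ι => ν).withDensity fun z => pathWeight k β e N 0 x z

theorem isProbabilityMeasure_pathLaw {N : ℕ} {x : X} (h0 : pathMass k β e ν N 0 x ≠ 0)
    (ht : pathMass k β e ν N 0 x ≠ ⊤) : IsProbabilityMeasure (pathLaw e ν k β N x) := by
  refine ⟨?_⟩
  rw [pathLaw, Measure.smul_apply, withDensity_apply _ MeasurableSet.univ,
    Measure.restrict_univ, smul_eq_mul]
  exact ENNReal.inv_mul_cancel h0 ht

variable [IsProbabilityMeasure ν]

theorem map_forgetBefore_le (hk : ∀ t, Measurable (Function.uncurry (k t)))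
    (hβ : Measurable β) {N n : ℕ} (hn : n + 1 ≤ N) (he : Set.InjOn e (Set.Icc 1 N)) (x₀ x : X)
    {f : X → ℝ≥0∞}
    (hfx : ∀ z, f z ≤ (pathMass k β e ν N 0 x)⁻¹ * stepKernel k ν 0 n x z) :
    ((Measure.pi fun _ : ι => ν).withDensity fun z => f (z (e (n + 1)))
        * pathWeight k β e (N - (n + 1)) (n + 1) (z (e (n + 1))) z).map
        (forgetBefore e x₀ (n + 1))
      ≤ (pathLaw e ν k β N x).map (forgetBefore e x₀ (n + 1)) := by
  classical
  have hT := measurable_forgetBefore e x₀ (n + 1)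
  refine Measure.le_iff.2 fun A hA => ?_
  set F : (ι → X) → ℝ≥0∞ := (forgetBefore e x₀ (n + 1) ⁻¹' A).indicator 1 with hF
  have hFm : Measurable F := measurable_one.indicator (hT hA)
  have hind : ∀ G : (ι → X) → ℝ≥0∞,
      ((Measure.pi fun _ : ι => ν).withDensity G) (forgetBefore e x₀ (n + 1) ⁻¹' A)
        = ∫⁻ z, F z * G z ∂(Measure.pi fun _ : ι => ν) := fun G => by
    rw [withDensity_apply _ (hT hA), ← lintegral_indicator (hT hA)]
    refine lintegral_congr fun z => ?_
    rw [hF, ← Set.indicator_mul_left]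
    simp
  have htail := lintegral_mul_pathWeight e ν hk hβ n (N - (n + 1)) 0 x hFm
    (he.mono (Set.Icc_subset_Icc (by omega) (by omega))) (fun j h1 h2 z w => by
      have := forgetBefore_update e x₀ (t := n + 1) h1 (by omega) z w
      simp only [hF, Set.indicator, Set.mem_preimage, this, Pi.one_apply])
  rw [show n + 1 + (N - (n + 1)) = N by omega, zero_add] at htail
  rw [Measure.map_apply hT hA, Measure.map_apply hT hA, pathLaw, Measure.smul_apply, hind, hind,
    htail, smul_eq_mul, ← lintegral_const_mul]
  · refine lintegral_mono fun z => ?_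
    calc F z * (f (z (e (n + 1))) * pathWeight k β e (N - (n + 1)) (n + 1) (z (e (n + 1))) z)
        ≤ F z * ((pathMass k β e ν N 0 x)⁻¹ * stepKernel k ν 0 n x (z (e (n + 1)))
          * pathWeight k β e (N - (n + 1)) (n + 1) (z (e (n + 1))) z) := by
          gcongr
          exact hfx _
      _ = _ := by ring
  · refine hFm.mul (Measurable.mul ?_ (measurable_pathWeight_eval e hk hβ _ _ _))
    exact (measurable_stepKernel ν hk 0 n).comp (measurable_const.prodMk (measurable_pi_apply _))

/-- Paths started at `x` and `x'` can be coupled with meeting times controlled by the `p + 1`-step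
Doeblin condition with constant `ε = 1 - α`. -/
theorem exists_coupling_pathLaw [StandardBorelSpace X]
    (hk : ∀ t, Measurable (Function.uncurry (k t)))
    (hβ : Measurable β) {N p : ℕ} (he : Set.InjOn e (Set.Icc 1 N)) {ε α : ℝ≥0∞}
    (hα : α + ε = 1)
    (hQ : ∀ t, t + p + 1 ≤ N → ∃ (γ : X → ℝ≥0∞) (r R : ℝ≥0∞), Measurable γ ∧ ε * R ≤ r ∧ r ≠ 0 ∧
      ∀ y z, r * γ z ≤ stepKernel k ν t p y z ∧ stepKernel k ν t p y z ≤ R * γ z)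
    {x x' : X} (hx0 : pathMass k β e ν N 0 x ≠ 0) (hxt : pathMass k β e ν N 0 x ≠ ⊤)
    (hx0' : pathMass k β e ν N 0 x' ≠ 0) (hxt' : pathMass k β e ν N 0 x' ≠ ⊤) :
    ∃ Ψ : Measure ((ι → X) × (ι → X)), IsProbabilityMeasure Ψ ∧
      Ψ.map Prod.fst = pathLaw e ν k β N x ∧ Ψ.map Prod.snd = pathLaw e ν k β N x' ∧
      ∀ j, 1 ≤ j → j ≤ N → Ψ {q | q.1 (e j) ≠ q.2 (e j)} ≤ α ^ (j / (p + 1)) := by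
  have hP := isProbabilityMeasure_pathLaw e ν hx0 hxt
  have hP' := isProbabilityMeasure_pathLaw e ν hx0' hxt'
  obtain ⟨Ψ, h1, h2, hΨ⟩ := exists_coupling_tails (N + 1)
    (fun i => forgetBefore e x (i * (p + 1))) (fun i => measurable_forgetBefore e x _)
    (fun i l hil => forgetBefore_comp e x (Nat.mul_le_mul_right _ hil))
    (pathLaw e ν k β N x) (pathLaw e ν k β N x') (by rw [measure_univ, measure_univ])
  have hΨ1 : IsProbabilityMeasure Ψ := ⟨by
    rw [← Set.preimage_univ (f := Prod.fst), ← Measure.map_apply measurable_fst MeasurableSet.univ,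
      h1, measure_univ]⟩
  refine ⟨Ψ, hΨ1, h1, h2, fun j hj hjN => ?_⟩
  have hdiv : j / (p + 1) * (p + 1) ≤ j := Nat.div_mul_le_self j (p + 1)
  have hlt : j / (p + 1) < N + 1 := (Nat.div_le_self _ _).trans_lt (by omega)
  generalize j / (p + 1) = i at hdiv hlt
  rcases i with _ | i
  · rw [pow_zero]
    exact prob_le_one
  have hi : (i + 1) * (p + 1) = i * (p + 1) + p + 1 := by ring
  have htail := hΨ (i + 1) hlt
  simp only [measure_univ] at htail
  rw [hi] at hdiv htail
  obtain ⟨f, hf, hfx, hfx', hfm⟩ := exists_common_minorant e ν hk hβ he hα hQ hx0 hxt hx0' hxt' i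
    (hdiv.trans hjN)
  set n := i * (p + 1) + p with hn
  have hle := le_inf (map_forgetBefore_le e ν hk hβ (hdiv.trans hjN) he x x hfx)
    (map_forgetBefore_le e ν hk hβ (hdiv.trans hjN) he x x' hfx')
  have hmass := Measure.le_iff'.1 hle Set.univ
  rw [Measure.map_apply (measurable_forgetBefore e x _) MeasurableSet.univ, Set.preimage_univ,
    withDensity_apply _ MeasurableSet.univ, Measure.restrict_univ,
    lintegral_eval_mul_pathWeight e ν hk hβ hf (N - (n + 1)) (n + 1) fun l hl1 hl2 hl => by
      have := he (Set.mem_Icc.2 ⟨by omega, by omega⟩) (Set.mem_Icc.2 ⟨by omega, by omega⟩) hl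
      omega] at hmass
  set I := ((pathLaw e ν k β N x).map (forgetBefore e x (n + 1))
    ⊓ (pathLaw e ν k β N x').map (forgetBefore e x (n + 1))) Set.univ with hI
  have hIt : I ≠ ⊤ := ne_top_of_le_ne_top ENNReal.one_ne_top (le_add_self.trans htail)
  calc Ψ {q | q.1 (e j) ≠ q.2 (e j)}
      ≤ Ψ {q | forgetBefore e x (n + 1) q.1 ≠ forgetBefore e x (n + 1) q.2} := by
        refine measure_mono fun q hq hq' => hq ?_
        have := congrFun hq' (e j)
        rwa [forgetBefore_apply e x he hj hjN hdiv, forgetBefore_apply e x he hj hjN hdiv] at this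
    _ ≤ α ^ (i + 1) := by
        refine (ENNReal.add_le_add_iff_right hIt).1 (htail.trans (hfm.trans ?_))
        rw [add_comm]
        gcongr

end PathCoupling

section Homogeneous

variable {X : Type*} [MeasurableSpace X] (ν : Measure X) {K : X → X → ℝ≥0∞}

theorem stepKernel_const (t n : ℕ) :
    stepKernel (fun _ => K) ν t n = stepKernel (fun _ => K) ν 0 n := by
  induction n with
  | zero => rfl
  | succ n ih => funext x z; simp only [stepKernel, ih]

variable [IsProbabilityMeasure ν]

/-- Chapman–Kolmogorov, splitting off the first step. -/
theorem stepKernel_const_succ (hK : Measurable (Function.uncurry K)) (n : ℕ) (x z : X) :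
    stepKernel (fun _ => K) ν 0 (n + 1) x z
      = ∫⁻ y, K x y * stepKernel (fun _ => K) ν 0 n y z ∂ν := by
  have := stepKernel_add ν (k := fun _ => K) (fun _ => hK) 0 0 n x z
  rw [zero_add, add_comm 1 n, stepKernel_const] at this
  simp only [stepKernel_const ν _ n] at this
  exact this

theorem stepKernel_swap (hK : Measurable (Function.uncurry K)) (n : ℕ) (x z : X) :
    stepKernel (fun _ => Function.swap K) ν 0 n x z = stepKernel (fun _ => K) ν 0 n z x := by
  induction n generalizing z with
  | zero => rfl
  | succ n ih =>
    rw [stepKernel_const_succ ν hK, stepKernel]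
    refine lintegral_congr fun y => ?_
    rw [ih, mul_comm]

theorem lintegral_stepKernel (hK : Measurable (Function.uncurry K))
    (hK1 : ∀ x, ∫⁻ y, K x y ∂ν = 1) (n : ℕ) (x : X) :
    ∫⁻ z, stepKernel (fun _ => K) ν 0 n x z ∂ν = 1 := by
  induction n with
  | zero => exact hK1 x
  | succ n ih =>
    have hS := measurable_stepKernel ν (k := fun _ => K) (fun _ => hK) 0 n
    simp only [stepKernel]
    rw [lintegral_lintegral_swap]
    · rw [← ih]
      refine lintegral_congr fun y => ?_
      rw [lintegral_const_mul _ (by exact hK.comp measurable_prodMk_left), hK1, mul_one]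
    · refine Measurable.aemeasurable ?_
      exact (hS.comp (measurable_const.prodMk measurable_snd)).mul
        (hK.comp (measurable_snd.prodMk measurable_fst))

theorem stepKernel_le (hK : Measurable (Function.uncurry K))
    (hK1 : ∀ x, ∫⁻ y, K x y ∂ν = 1) {b : ℝ≥0∞} (hKb : ∀ x y, K x y ≤ b) (n : ℕ) (x z : X) :
    stepKernel (fun _ => K) ν 0 n x z ≤ b := by
  cases n with
  | zero => exact hKb x z
  | succ n =>
    have hS := measurable_stepKernel ν (k := fun _ => K) (fun _ => hK) 0 n
    calc stepKernel (fun _ => K) ν 0 (n + 1) x z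
        ≤ ∫⁻ y, stepKernel (fun _ => K) ν 0 n x y * b ∂ν := by
          rw [stepKernel]
          gcongr with y
          exact hKb y z
      _ = b := by
          rw [lintegral_mul_const _ (by exact hS.comp measurable_prodMk_left),
            lintegral_stepKernel ν hK hK1, one_mul]

variable {G : ℕ → X → ℝ≥0∞} {D : ℝ≥0∞} {lo : ℕ → ℝ≥0∞}

theorem le_stepKernel_mul (hK : Measurable (Function.uncurry K))
    (hlo : ∀ t x, lo t ≤ G t x) (t n : ℕ) (x z : X) :
    (∏ j ∈ Finset.range n, lo (t + j)) * (stepKernel (fun _ => K) ν 0 n x z * G (t + n) z)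
      ≤ stepKernel (fun t x y => K x y * G t y) ν t n x z := by
  induction n generalizing z with
  | zero => simp [stepKernel]
  | succ n ih =>
    have hS := measurable_stepKernel ν (k := fun _ => K) (fun _ => hK) 0 n
    rw [stepKernel, stepKernel, Finset.prod_range_succ, ← lintegral_mul_const,
      ← lintegral_const_mul]
    · refine lintegral_mono fun y => ?_
      refine le_trans ?_ (mul_le_mul_left (ih y) _)
      calc _ = (∏ j ∈ Finset.range n, lo (t + j)) * (stepKernel (fun _ => K) ν 0 n x y * lo (t + n))
            * (K y z * G (t + n + 1) z) := by rw [← add_assoc]; ring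
        _ ≤ _ := by gcongr; exact hlo _ _
    · exact ((hS.comp measurable_prodMk_left).mul (hK.comp measurable_prodMk_right)).mul_const _
    · exact (hS.comp measurable_prodMk_left).mul (hK.comp measurable_prodMk_right)

theorem stepKernel_mul_le (hK : Measurable (Function.uncurry K))
    (hhi : ∀ t x, G t x ≤ D * lo t) (t n : ℕ) (x z : X) :
    stepKernel (fun t x y => K x y * G t y) ν t n x z
      ≤ (∏ j ∈ Finset.range n, D * lo (t + j))
        * (stepKernel (fun _ => K) ν 0 n x z * G (t + n) z) := by
  induction n generalizing z with
  | zero => simp [stepKernel]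
  | succ n ih =>
    have hS := measurable_stepKernel ν (k := fun _ => K) (fun _ => hK) 0 n
    rw [stepKernel, stepKernel, Finset.prod_range_succ, ← lintegral_mul_const,
      ← lintegral_const_mul]
    · refine lintegral_mono fun y => ?_
      refine (mul_le_mul_left (ih y) _).trans ?_
      calc _ ≤ (∏ j ∈ Finset.range n, D * lo (t + j))
            * (stepKernel (fun _ => K) ν 0 n x y * (D * lo (t + n)))
            * (K y z * G (t + n + 1) z) := by gcongr; exact hhi _ _
        _ = _ := by rw [← add_assoc]; ring
    · exact ((hS.comp measurable_prodMk_left).mul (hK.comp measurable_prodMk_right)).mul_const _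
    · exact (hS.comp measurable_prodMk_left).mul (hK.comp measurable_prodMk_right)

/-- The coupling of path laws for a homogeneous transition density `K` with `a ≤ K^{p+1} ≤ b` and
potentials with oscillation at most `D`. -/
theorem exists_coupling_pathLaw_of_potential [StandardBorelSpace X] {ι : Type*} [Fintype ι]
    (e : ℕ → ι) {β : X → ℝ≥0∞} (hK : Measurable (Function.uncurry K))
    (hG : ∀ t, Measurable (G t)) (hG0 : ∀ t x, G t x ≠ 0) (hD : D ≠ ⊤)
    (hGD : ∀ t x y, G t x ≤ D * G t y) (hβ : Measurable β) {N p : ℕ}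
    (he : Set.InjOn e (Set.Icc 1 N)) {ε α a b : ℝ≥0∞} (hα : α + ε = 1) (ha : a ≠ 0)
    (hab : ε * (D ^ p * b) ≤ a)
    (hKa : ∀ x z, a ≤ stepKernel (fun _ => K) ν 0 p x z)
    (hKb : ∀ x z, stepKernel (fun _ => K) ν 0 p x z ≤ b)
    {x x' : X}
    (hx0 : pathMass (fun t x y => K x y * G t y) β e ν N 0 x ≠ 0)
    (hxt : pathMass (fun t x y => K x y * G t y) β e ν N 0 x ≠ ⊤)
    (hx0' : pathMass (fun t x y => K x y * G t y) β e ν N 0 x' ≠ 0)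
    (hxt' : pathMass (fun t x y => K x y * G t y) β e ν N 0 x' ≠ ⊤) :
    ∃ Ψ : Measure ((ι → X) × (ι → X)), IsProbabilityMeasure Ψ ∧
      Ψ.map Prod.fst = pathLaw e ν (fun t x y => K x y * G t y) β N x ∧
      Ψ.map Prod.snd = pathLaw e ν (fun t x y => K x y * G t y) β N x' ∧
      ∀ j, 1 ≤ j → j ≤ N → Ψ {q | q.1 (e j) ≠ q.2 (e j)} ≤ α ^ (j / (p + 1)) := by
  have hk : ∀ t, Measurable (Function.uncurry fun x y => K x y * G t y) := fun t =>
    hK.mul ((hG t).comp measurable_snd)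
  have hhi : ∀ t y, G t y ≤ D * ⨅ w, G t w := fun t y => by
    rcases eq_or_ne D 0 with h0 | h0
    · exact absurd (le_zero_iff.1 ((hGD t y y).trans (by simp [h0]))) (hG0 t y)
    · rw [ENNReal.mul_iInf_of_ne h0 hD]
      exact le_iInf fun w => hGD t y w
  have hlo0 : ∀ t, ⨅ w, G t w ≠ 0 := fun t h0 =>
    hG0 t x (le_zero_iff.1 ((hhi t x).trans (by simp [h0])))
  refine exists_coupling_pathLaw e ν hk hβ he hα (fun t _ => ?_) hx0 hxt hx0' hxt'
  set P := ∏ j ∈ Finset.range p, ⨅ w, G (t + j) w with hP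
  refine ⟨G (t + p), P * a, D ^ p * P * b, hG _, ?_, ?_, fun y z => ⟨?_, ?_⟩⟩
  · calc ε * (D ^ p * P * b) = P * (ε * (D ^ p * b)) := by ring
      _ ≤ P * a := by gcongr
  · exact mul_ne_zero (Finset.prod_ne_zero_iff.2 fun j _ => hlo0 _) ha
  · refine le_trans ?_ (le_stepKernel_mul ν hK (fun t x => iInf_le (G t) x) t p y z)
    rw [mul_assoc]
    gcongr
    exact hKa y z
  · refine (stepKernel_mul_le ν hK hhi t p y z).trans ?_
    rw [Finset.prod_mul_distrib, Finset.prod_const, Finset.card_range, mul_assoc (D ^ p * P)]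
    gcongr
    exact hKb y z

end Homogeneous

section Minorization

variable {X : Type*} [MeasurableSpace X] {ν0 : Measure X} [IsProbabilityMeasure ν0]
  {mker : X → X → ℝ}

theorem lintegral_ofReal_eq_of_integral_pos {Y : Type*} [MeasurableSpace Y] {μ : Measure Y}
    {f : Y → ℝ} (hf : ∀ y, 0 ≤ f y) (hpos : 0 < ∫ y, f y ∂μ) :
    ∫⁻ y, ENNReal.ofReal (f y) ∂μ = ENNReal.ofReal (∫ y, f y ∂μ) :=
  (ofReal_integral_eq_lintegral_ofReal (not_imp_comm.1 integral_undef hpos.ne')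
    (Filter.Eventually.of_forall hf)).symm

theorem ofReal_le_stepKernel {h : ℕ} (hh : 1 ≤ h) {σm : ℝ} (hσm : 0 < σm)
    (hm_meas : Measurable (Function.uncurry mker)) (hm_nonneg : ∀ x x', 0 ≤ mker x x')
    (hS1 : S1minor ν0 mker h σm) (x z : X) :
    ENNReal.ofReal σm
      ≤ stepKernel (fun _ x y => ENNReal.ofReal (mker x y)) ν0 0 (h - 1) x z := by
  obtain ⟨p, rfl⟩ := Nat.exists_eq_add_of_le' hh
  rw [Nat.add_sub_cancel]
  have key := hS1 x z
  have hpos := hσm.trans_le key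
  have hK : Measurable (Function.uncurry fun x y => ENNReal.ofReal (mker x y)) :=
    hm_meas.ennreal_ofReal
  refine (ENNReal.ofReal_le_ofReal key).trans ?_
  rw [← lintegral_ofReal_eq_of_integral_pos
    (fun _ => Finset.prod_nonneg fun _ _ => hm_nonneg _ _) hpos]
  rw [Nat.add_sub_cancel]
  rcases p with _ | q
  · simp [ext1, stepKernel]
  · let e : ℕ → Fin (q + 1) := fun j => Fin.ofNat (q + 1) (j - 1)
    have he : Set.InjOn e (Set.Icc (0 + 1) (0 + q + 1 + 0)) := by
      intro i hi j hj hij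
      simp only [Set.mem_Icc] at hi hj
      have := congrArg Fin.val hij
      simp only [e, Fin.val_ofNat] at this
      rw [Nat.mod_eq_of_lt (by omega), Nat.mod_eq_of_lt (by omega)] at this
      omega
    have hm := pathMass_eq_lintegral e ν0 (k := fun _ x y => ENNReal.ofReal (mker x y))
      (β := fun y => ENNReal.ofReal (mker y z)) (fun _ => hK) (hK.comp measurable_prodMk_right)
      q 0 0 x he
    refine le_of_eq ?_
    rw [stepKernel]
    refine Eq.trans ?_ (hm.trans ?_)
    · refine lintegral_congr fun w => ?_
      rw [ENNReal.ofReal_prod_of_nonneg fun _ _ => hm_nonneg _ _, Finset.prod_range_succ]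
      have := pathWeight_eq_prod (fun _ x y => ENNReal.ofReal (mker x y))
        (fun y => ENNReal.ofReal (mker y z)) e (q + 1) 0 w (ext1 x z w) fun j h1 h2 => by
          simp only [ext1, h1, h2, and_self, dif_pos, e]
          congr 1
          ext
          simp only [Fin.val_ofNat, zero_add]
          rw [Nat.mod_eq_of_lt (by omega)]
      rw [show ext1 x z w 0 = x by simp [ext1]] at this
      rw [add_zero, this]
      simp [ext1]
    · simp [pathMass, pathWeight]

end Minorization

section Block

variable {X : Type*} {mker : X → X → ℝ} {g : ℕ → X → ℝ} {s u : ℕ}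

theorem extBlock_sub_one (hs : 1 < s) (xm xp : X) (z : Fin (u - s + 1) → X) :
    extBlock s u xm xp z (s - 1) = xm := by
  rw [extBlock, dif_neg (by omega), if_pos (by omega)]

theorem extBlock_add_one (hsu : s ≤ u) (xm xp : X) (z : Fin (u - s + 1) → X) :
    extBlock s u xm xp z (u + 1) = xp := by
  rw [extBlock, dif_neg (by omega), if_neg (by omega)]

/-- The block density in forward time. -/
theorem blockDens_eq_prod_range (hs : 1 < s) (hsu : s ≤ u) (xm xp : X) (z : Fin (u - s + 1) → X) :
    blockDens mker g s u xm xp z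
      = (∏ j ∈ Finset.range (u - s + 1), mker (extBlock s u xm xp z (s - 1 + j))
          (extBlock s u xm xp z (s + j)) * g (s + j) (extBlock s u xm xp z (s + j)))
        * mker (extBlock s u xm xp z u) xp := by
  rw [blockDens, ← Finset.Ico_add_one_right_eq_Icc, Finset.prod_Ico_eq_prod_range,
    show u + 1 - s = u - s + 1 by omega]
  congr 1
  refine Finset.prod_congr rfl fun j _ => ?_
  rw [show s + j - 1 = s - 1 + j by omega]

/-- The block density in backward time. -/
theorem blockDens_eq_prod_range_reverse (hs : 1 < s) (hsu : s ≤ u) (xm xp : X)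
    (z : Fin (u - s + 1) → X) :
    blockDens mker g s u xm xp z
      = (∏ j ∈ Finset.range (u - s + 1), mker (extBlock s u xm xp z (u - j))
          (extBlock s u xm xp z (u + 1 - j)) * g (u - j) (extBlock s u xm xp z (u - j)))
        * mker xm (extBlock s u xm xp z s) := by
  rw [blockDens_eq_prod_range hs hsu]
  obtain ⟨s, rfl⟩ := Nat.exists_eq_add_of_lt hs
  obtain ⟨M, rfl⟩ := Nat.exists_eq_add_of_le hsu
  rw [Nat.add_sub_cancel_left, Nat.add_sub_cancel]
  set w := extBlock (1 + s + 1) (1 + s + 1 + M) xm xp z with hw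
  have h0 : w (1 + s) = xm := extBlock_sub_one hs xm xp z
  have h1 : w (1 + s + 1 + M + 1) = xp := extBlock_add_one hsu xm xp z
  have hm : (∏ j ∈ Finset.range (M + 1), mker (w (1 + s + j)) (w (1 + s + 1 + j)))
        * mker (w (1 + s + 1 + M)) xp
      = (∏ j ∈ Finset.range (M + 1), mker (w (1 + s + 1 + j)) (w (1 + s + 1 + j + 1)))
        * mker xm (w (1 + s + 1)) := by
    have h2 := Finset.prod_range_succ (fun j => mker (w (1 + s + j)) (w (1 + s + j + 1))) (M + 1)
    rw [Finset.prod_range_succ'] at h2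
    rw [← h0, ← h1]
    simp only [add_right_comm (1 + s) 1, ← add_assoc, add_zero] at h2 ⊢
    exact h2.symm
  have hr : ∀ f : ℕ → ℝ, ∏ j ∈ Finset.range (M + 1), f j
      = ∏ j ∈ Finset.range (M + 1), f (M - j) := fun f => by
    rw [← Finset.prod_range_reflect f (M + 1), Nat.add_sub_cancel]
  rw [Finset.prod_mul_distrib, mul_right_comm, hm, mul_right_comm, ← Finset.prod_mul_distrib, hr]
  congr 1
  refine Finset.prod_congr rfl fun j hj => ?_
  have := Finset.mem_range.1 hj
  rw [show 1 + s + 1 + (M - j) = 1 + s + 1 + M - j by omega,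
    show 1 + s + 1 + M - j + 1 = 1 + s + 1 + M + 1 - j by omega]

theorem blockDens_nonneg (hm_nonneg : ∀ x x', 0 ≤ mker x x') (hg_pos : ∀ t x, 0 < g t x)
    (xm xp : X) (z : Fin (u - s + 1) → X) : 0 ≤ blockDens mker g s u xm xp z :=
  mul_nonneg (Finset.prod_nonneg fun _ _ => mul_nonneg (hm_nonneg _ _) (hg_pos _ _).le)
    (hm_nonneg _ _)

theorem ofReal_blockDens_eq_pathWeight (hm_nonneg : ∀ x x', 0 ≤ mker x x')
    (hg_pos : ∀ t x, 0 < g t x) (hs : 1 < s) (hsu : s ≤ u) (xm xp : X)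
    (z : Fin (u - s + 1) → X) :
    ENNReal.ofReal (blockDens mker g s u xm xp z)
      = pathWeight (fun j x y => ENNReal.ofReal (mker x y) * ENNReal.ofReal (g (s + j) y))
          (fun y => ENNReal.ofReal (mker y xp)) (fun j => Fin.ofNat (u - s + 1) (j - 1))
          (u - s + 1) 0 xm z := by
  have := pathWeight_eq_prod
    (fun j x y => ENNReal.ofReal (mker x y) * ENNReal.ofReal (g (s + j) y))
    (fun y => ENNReal.ofReal (mker y xp)) (fun j => Fin.ofNat (u - s + 1) (j - 1))
    (u - s + 1) 0 z (fun j => extBlock s u xm xp z (s - 1 + j)) fun j h1 h2 => by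
      rw [extBlock, dif_pos (by omega)]
      congr 1
      ext
      simp only [Fin.val_ofNat, zero_add]
      rw [Nat.mod_eq_of_lt (by omega)]
      omega
  rw [add_zero, extBlock_sub_one hs] at this
  rw [this, blockDens_eq_prod_range hs hsu, ENNReal.ofReal_mul
    (Finset.prod_nonneg fun _ _ => mul_nonneg (hm_nonneg _ _) (hg_pos _ _).le),
    ENNReal.ofReal_prod_of_nonneg fun _ _ => mul_nonneg (hm_nonneg _ _) (hg_pos _ _).le,
    show s - 1 + (u - s + 1) = u by omega]
  congr 1
  refine Finset.prod_congr rfl fun j _ => ?_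
  rw [ENNReal.ofReal_mul (hm_nonneg _ _), zero_add, show s - 1 + (j + 1) = s + j by omega]

theorem ofReal_blockDens_eq_pathWeight_reverse (hm_nonneg : ∀ x x', 0 ≤ mker x x')
    (hg_pos : ∀ t x, 0 < g t x) (hs : 1 < s) (hsu : s ≤ u) (xm xp : X)
    (z : Fin (u - s + 1) → X) :
    ENNReal.ofReal (blockDens mker g s u xm xp z)
      = pathWeight (fun j x y => ENNReal.ofReal (mker y x) * ENNReal.ofReal (g (u - j) y))
          (fun y => ENNReal.ofReal (mker xm y)) (fun j => Fin.ofNat (u - s + 1) (u - s + 1 - j))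
          (u - s + 1) 0 xp z := by
  have := pathWeight_eq_prod
    (fun j x y => ENNReal.ofReal (mker y x) * ENNReal.ofReal (g (u - j) y))
    (fun y => ENNReal.ofReal (mker xm y)) (fun j => Fin.ofNat (u - s + 1) (u - s + 1 - j))
    (u - s + 1) 0 z (fun j => extBlock s u xm xp z (u + 1 - j)) fun j h1 h2 => by
      rw [extBlock, dif_pos (by omega)]
      congr 1
      ext
      simp only [Fin.val_ofNat, zero_add]
      rw [Nat.mod_eq_of_lt (by omega)]
      omega
  rw [Nat.sub_zero, extBlock_add_one hsu] at this
  rw [this, blockDens_eq_prod_range_reverse hs hsu, ENNReal.ofReal_mul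
    (Finset.prod_nonneg fun _ _ => mul_nonneg (hm_nonneg _ _) (hg_pos _ _).le),
    ENNReal.ofReal_prod_of_nonneg fun _ _ => mul_nonneg (hm_nonneg _ _) (hg_pos _ _).le,
    show u + 1 - (u - s + 1) = s by omega]
  congr 1
  refine Finset.prod_congr rfl fun j _ => ?_
  rw [ENNReal.ofReal_mul (hm_nonneg _ _), zero_add, show u + 1 - (j + 1) = u - j by omega]

variable [MeasurableSpace X] {ν0 : Measure X}

theorem pathMass_eq_ofReal_blockZ (hm_nonneg : ∀ x x', 0 ≤ mker x x')
    (hg_pos : ∀ t x, 0 < g t x) {xm xp x : X} (hZ : 0 < blockZ ν0 mker g s u xm xp)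
    {k : ℕ → X → X → ℝ≥0∞} {β : X → ℝ≥0∞} {e : ℕ → Fin (u - s + 1)} {N : ℕ}
    (hw : ∀ z, ENNReal.ofReal (blockDens mker g s u xm xp z) = pathWeight k β e N 0 x z) :
    pathMass k β e ν0 N 0 x = ENNReal.ofReal (blockZ ν0 mker g s u xm xp) := by
  rw [blockZ, ← lintegral_ofReal_eq_of_integral_pos (blockDens_nonneg hm_nonneg hg_pos xm xp) hZ,
    pathMass]
  simp_rw [hw]

theorem pathLaw_eq_blockMeasure (hm_nonneg : ∀ x x', 0 ≤ mker x x')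
    (hg_pos : ∀ t x, 0 < g t x) {xm xp x : X} (hZ : 0 < blockZ ν0 mker g s u xm xp)
    {k : ℕ → X → X → ℝ≥0∞} {β : X → ℝ≥0∞} {e : ℕ → Fin (u - s + 1)} {N : ℕ}
    (hw : ∀ z, ENNReal.ofReal (blockDens mker g s u xm xp z) = pathWeight k β e N 0 x z) :
    pathLaw e ν0 k β N x = blockMeasure ν0 mker g s u xm xp := by
  rw [pathLaw, pathMass_eq_ofReal_blockZ hm_nonneg hg_pos hZ hw, blockMeasure]
  simp_rw [hw]

theorem toReal_le_pow {a : ℝ≥0∞} {α : ℝ} (hα : 0 ≤ α) {n : ℕ}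
    (h : a ≤ ENNReal.ofReal α ^ n) : a.toReal ≤ α ^ n :=
  ENNReal.toReal_le_of_le_ofReal (pow_nonneg hα n) (by rwa [ENNReal.ofReal_pow hα])

end Block

theorem stmt8 {X : Type*} [MeasurableSpace X] [StandardBorelSpace X]
    (ν0 : Measure X) [IsProbabilityMeasure ν0]
    (mker : X → X → ℝ) (g : ℕ → X → ℝ)
    (h : ℕ) (hh : 1 ≤ h) (σm σp δ : ℝ)
    (hσm : 0 < σm) (hσp : 0 < σp) (hδ : 1 ≤ δ)
    -- (S1)
    (hm_meas : Measurable (Function.uncurry mker))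
    (hm_nonneg : ∀ x x', 0 ≤ mker x x')
    (hm_le : ∀ x x', mker x x' ≤ σp)
    (hm_int : ∀ x, ∫ x', mker x x' ∂ν0 = 1)
    (hS1 : S1minor ν0 mker h σm)
    -- (S2)
    (hg_meas : ∀ t, Measurable (g t))
    (hg_pos : ∀ t x, 0 < g t x)
    (hg_bdd : ∀ t, ∃ C, ∀ x, g t x ≤ C)
    (hg_ratio : ∀ t (x y : X), g t x ≤ δ ^ ((h : ℝ))⁻¹ * g t y)
    -- the block
    (n s u : ℕ) (hs : 1 < s) (hsu : s ≤ u) (hun : u < n)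
    (hZ : ∀ xm xp : X, 0 < blockZ ν0 mker g s u xm xp) :
    -- (i): coupling in the left boundary value
    (∀ xp xm zm : X,
      ∃ Ψ : Measure ((Fin (u - s + 1) → X) × (Fin (u - s + 1) → X)),
        IsProbabilityMeasure Ψ ∧
        Ψ.map Prod.fst = blockMeasure ν0 mker g s u xm xp ∧
        Ψ.map Prod.snd = blockMeasure ν0 mker g s u zm xp ∧
        ∀ i : Fin (u - s + 1), (Ψ {q | q.1 i ≠ q.2 i}).toReal ≤
          (1 - δ ^ ((1 - (h : ℝ)) / h) * σm / σp) ^ (((i : ℕ) + 1) / h)) ∧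
    -- (ii): coupling in the right boundary value
    (∀ xm xp zp : X,
      ∃ Ψ : Measure ((Fin (u - s + 1) → X) × (Fin (u - s + 1) → X)),
        IsProbabilityMeasure Ψ ∧
        Ψ.map Prod.fst = blockMeasure ν0 mker g s u xm xp ∧
        Ψ.map Prod.snd = blockMeasure ν0 mker g s u xm zp ∧
        ∀ i : Fin (u - s + 1), (Ψ {q | q.1 i ≠ q.2 i}).toReal ≤
          (1 - δ ^ ((1 - (h : ℝ)) / h) * σm / σp) ^ ((u - s + 1 - (i : ℕ)) / h)) := by
  obtain ⟨p, rfl⟩ := Nat.exists_eq_add_of_le' hh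
  obtain ⟨x₀⟩ : Nonempty X := nonempty_of_isProbabilityMeasure ν0
  set K : X → X → ℝ≥0∞ := fun x y => ENNReal.ofReal (mker x y) with hKdef
  have hK : Measurable (Function.uncurry K) := hm_meas.ennreal_ofReal
  have hK1 : ∀ x, ∫⁻ y, K x y ∂ν0 = 1 := fun x => by
    rw [lintegral_ofReal_eq_of_integral_pos (hm_nonneg x) (by rw [hm_int]; exact one_pos), hm_int,
      ENNReal.ofReal_one]
  have hKa : ∀ x z, ENNReal.ofReal σm ≤ stepKernel (fun _ => K) ν0 0 p x z :=
    ofReal_le_stepKernel hh hσm hm_meas hm_nonneg hS1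
  have hKb : ∀ x z, stepKernel (fun _ => K) ν0 0 p x z ≤ ENNReal.ofReal σp :=
    stepKernel_le ν0 hK hK1 (fun x y => ENNReal.ofReal_le_ofReal (hm_le x y)) p
  have hmp : σm ≤ σp := (ENNReal.ofReal_le_ofReal_iff hσp.le).1 ((hKa x₀ x₀).trans (hKb x₀ x₀))
  have hδ0 : 0 < δ := one_pos.trans_le hδ
  set D : ℝ := δ ^ (((p + 1 : ℕ) : ℝ))⁻¹ with hDdef
  have hD0 : 0 < D := Real.rpow_pos_of_pos hδ0 _
  set c : ℝ := δ ^ ((1 - ((p + 1 : ℕ) : ℝ)) / ((p + 1 : ℕ) : ℝ)) with hcdef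
  have hc0 : 0 < c := Real.rpow_pos_of_pos hδ0 _
  have hcD : c * D ^ p = 1 := by
    rw [hcdef, hDdef, ← Real.rpow_natCast, ← Real.rpow_mul hδ0.le, ← Real.rpow_add hδ0]
    convert Real.rpow_zero δ using 2
    push_cast
    field_simp
    ring
  have hc1 : c ≤ 1 := Real.rpow_le_one_of_one_le_of_nonpos hδ
    (div_nonpos_of_nonpos_of_nonneg (by push_cast; linarith [p.cast_nonneg (α := ℝ)])
      (Nat.cast_nonneg _))
  have hε0 : 0 ≤ c * σm / σp := by positivity
  have hε1 : c * σm / σp ≤ 1 := by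
    rw [div_le_one hσp]
    nlinarith
  have hα0 : 0 ≤ 1 - c * σm / σp := sub_nonneg.2 hε1
  have hαε : ENNReal.ofReal (1 - c * σm / σp) + ENNReal.ofReal (c * σm / σp) = 1 := by
    rw [← ENNReal.ofReal_add hα0 hε0, sub_add_cancel, ENNReal.ofReal_one]
  have hab : ENNReal.ofReal (c * σm / σp) * (ENNReal.ofReal D ^ p * ENNReal.ofReal σp)
      ≤ ENNReal.ofReal σm := by
    rw [← ENNReal.ofReal_pow hD0.le, ← ENNReal.ofReal_mul (by positivity),
      ← ENNReal.ofReal_mul hε0]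
    refine ENNReal.ofReal_le_ofReal (le_of_eq ?_)
    rw [show c * σm / σp * (D ^ p * σp) = c * D ^ p * σm * (σp / σp) by ring, hcD,
      div_self hσp.ne', one_mul, mul_one]
  have hGD : ∀ t x y, ENNReal.ofReal (g t x) ≤ ENNReal.ofReal D * ENNReal.ofReal (g t y) :=
    fun t x y => by
      rw [← ENNReal.ofReal_mul hD0.le]
      exact ENNReal.ofReal_le_ofReal (hg_ratio t x y)
  have hG0 : ∀ t x, ENNReal.ofReal (g t x) ≠ 0 := fun t x =>
    (ENNReal.ofReal_pos.2 (hg_pos t x)).ne'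
  have hZ0 : ∀ xm xp, ENNReal.ofReal (blockZ ν0 mker g s u xm xp) ≠ 0 := fun xm xp =>
    (ENNReal.ofReal_pos.2 (hZ xm xp)).ne'
  refine ⟨fun xp xm zm => ?_, fun xm xp zp => ?_⟩
  · have hw := fun x => ofReal_blockDens_eq_pathWeight hm_nonneg hg_pos hs hsu x xp
    have hM := fun x => pathMass_eq_ofReal_blockZ hm_nonneg hg_pos (hZ x xp) (hw x)
    have he : Set.InjOn (fun j => Fin.ofNat (u - s + 1) (j - 1)) (Set.Icc 1 (u - s + 1)) := by
      intro i hi j hj hij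
      simp only [Set.mem_Icc] at hi hj
      have := congrArg Fin.val hij
      simp only [Fin.val_ofNat] at this
      rw [Nat.mod_eq_of_lt (by omega), Nat.mod_eq_of_lt (by omega)] at this
      omega
    obtain ⟨Ψ, hΨ, h1, h2, h3⟩ := exists_coupling_pathLaw_of_potential ν0
      (fun j => Fin.ofNat (u - s + 1) (j - 1)) hK (fun t => (hg_meas (s + t)).ennreal_ofReal)
      (fun t => hG0 (s + t)) ENNReal.ofReal_ne_top (fun t => hGD (s + t))
      (β := fun y => K y xp) (hK.comp measurable_prodMk_right) he hαε
      (ENNReal.ofReal_pos.2 hσm).ne' hab hKa hKb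
      ((hM xm).trans_ne (hZ0 xm xp)) ((hM xm).trans_ne ENNReal.ofReal_ne_top)
      ((hM zm).trans_ne (hZ0 zm xp)) ((hM zm).trans_ne ENNReal.ofReal_ne_top)
    refine ⟨Ψ, hΨ, h1.trans (pathLaw_eq_blockMeasure hm_nonneg hg_pos (hZ xm xp) (hw xm)),
      h2.trans (pathLaw_eq_blockMeasure hm_nonneg hg_pos (hZ zm xp) (hw zm)), fun i => ?_⟩
    have hi := h3 (i + 1) (by omega) (by omega)
    rw [Nat.add_sub_cancel, Fin.ofNat_val_eq_self] at hi
    exact toReal_le_pow hα0 hi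
  · have hw := fun x => ofReal_blockDens_eq_pathWeight_reverse hm_nonneg hg_pos hs hsu xm x
    have hM := fun x => pathMass_eq_ofReal_blockZ hm_nonneg hg_pos (hZ xm x) (hw x)
    have he : Set.InjOn (fun j => Fin.ofNat (u - s + 1) (u - s + 1 - j))
        (Set.Icc 1 (u - s + 1)) := by
      intro i hi j hj hij
      simp only [Set.mem_Icc] at hi hj
      have := congrArg Fin.val hij
      simp only [Fin.val_ofNat] at this
      rw [Nat.mod_eq_of_lt (by omega), Nat.mod_eq_of_lt (by omega)] at this
      omega
    obtain ⟨Ψ, hΨ, h1, h2, h3⟩ := exists_coupling_pathLaw_of_potential ν0 (K := Function.swap K)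
      (fun j => Fin.ofNat (u - s + 1) (u - s + 1 - j)) (hK.comp measurable_swap)
      (fun t => (hg_meas (u - t)).ennreal_ofReal)
      (fun t => hG0 (u - t)) ENNReal.ofReal_ne_top (fun t => hGD (u - t))
      (β := fun y => K xm y) (hK.comp measurable_prodMk_left) he hαε
      (ENNReal.ofReal_pos.2 hσm).ne' hab
      (fun x z => by rw [stepKernel_swap ν0 hK]; exact hKa z x)
      (fun x z => by rw [stepKernel_swap ν0 hK]; exact hKb z x)
      ((hM xp).trans_ne (hZ0 xm xp)) ((hM xp).trans_ne ENNReal.ofReal_ne_top)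
      ((hM zp).trans_ne (hZ0 xm zp)) ((hM zp).trans_ne ENNReal.ofReal_ne_top)
    refine ⟨Ψ, hΨ, h1.trans (pathLaw_eq_blockMeasure hm_nonneg hg_pos (hZ xm xp) (hw xp)),
      h2.trans (pathLaw_eq_blockMeasure hm_nonneg hg_pos (hZ xm zp) (hw zp)), fun i => ?_⟩
    have hi := h3 (u - s + 1 - i) (by omega) (by omega)
    rw [Nat.sub_sub_self (by omega), Fin.ofNat_val_eq_self] at hi
    exact toReal_le_pow hα0 hi
end

section
/- Let X be a standard Borel space, let t ≥ 1 and h ≥ 1 be integers, and for i = 1,…,t let P_i be a Markov kernel on X. For i = 1,…,⌊t/h⌋ let Q_i = P_{(i−1)h+1}∘⋯∘P_{ih} be the composite kernel (applying P_{(i−1)h+1} first), and assume there exist probability measures ν_i on X and a constant α ∈ [0,1] such that Q_i(x, A) ≥ α·ν_i(A) for all x ∈ X and all measurable A. For x_0 ∈ X let μ_{x_0} denote the law on X^t of the inhomogeneous Markov chain (X_1,…,X_t) with X_i ∼ P_i(X_{i−1},·) started from X_0 = x_0. Then for any x_0, y_0 ∈ X there exists a coupling Ψ of μ_{x_0} and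 μ_{y_0} such that Ψ({(x,y) : x_i ≠ y_i}) ≤ (1−α)^{⌊i/h⌋} for every i ∈ {1,…,t}. -/
open MeasureTheory ProbabilityTheory

/-- The law on `X^t` of the inhomogeneous Markov chain `(X_1, …, X_t)` with
`X_i ∼ P i (X_{i-1}, ·)` started from `X_0 = x0`. -/
noncomputable def chainLaw {X : Type*} [MeasurableSpace X] (P : ℕ → Kernel X X) (x0 : X) :
    (t : ℕ) → Measure (Fin t → X)
  | 0 => Measure.dirac Fin.elim0
  | (k + 1) =>
      (chainLaw P x0 k).bind fun xs =>
        (P (k + 1) (if hk : k = 0 then x0 else xs ⟨k - 1, by omega⟩)).map (Fin.snoc xs)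

/-- The composite kernel `P_{(i-1)h+1} ∘ ⋯ ∘ P_{ih}` (applying `P ((i-1)h+1)` first). -/
noncomputable def blockKernel {X : Type*} [MeasurableSpace X] (P : ℕ → Kernel X X)
    (h i : ℕ) : Kernel X X :=
  ((List.range h).map fun l => P ((i - 1) * h + l + 1)).foldl
    (fun acc κ => κ ∘ₖ acc) Kernel.id

namespace MarkovCoupling

open scoped ENNReal

section Gluing

variable {E X : Type*} [MeasurableSpace E] [MeasurableSpace X]

/-- A measure dominated by a pushforward `μ.map f` lifts to a summand of `μ`. -/
lemma exists_add_eq_of_le_map {μ : Measure E} [IsFiniteMeasure μ] {f : E → X} (hf : Measurable f)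
    {ρ : Measure X} (hρ : ρ ≤ μ.map f) :
    ∃ V W : Measure E, V + W = μ ∧ V.map f = ρ := by
  have : IsFiniteMeasure ρ := isFiniteMeasure_of_le _ hρ
  have hg := Measure.measurable_rnDeriv ρ (μ.map f)
  have hle : μ.withDensity (ρ.rnDeriv (μ.map f) ∘ f) ≤ μ := by
    conv_rhs => rw [← withDensity_one (μ := μ)]
    exact withDensity_mono (ae_of_ae_map hf.aemeasurable (Measure.rnDeriv_le_one_of_le hρ))
  have := isFiniteMeasure_of_le _ hle
  refine ⟨μ.withDensity (ρ.rnDeriv (μ.map f) ∘ f), μ - μ.withDensity (ρ.rnDeriv (μ.map f) ∘ f),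
    by rw [add_comm, Measure.sub_add_cancel_of_le hle], ?_⟩
  conv_rhs =>
    rw [← Measure.withDensity_rnDeriv_eq _ _ (Measure.absolutelyContinuous_of_le hρ)]
  ext s hs
  rw [Measure.map_apply hf hs, withDensity_apply _ (hf hs), withDensity_apply _ hs,
    setLIntegral_map hs hg hf]
  rfl

/-- Two finite measures with the same pushforward under `f` have a coupling supported on
`{f q.1 = f q.2}`. -/
lemma exists_coupling_of_map_eq [StandardBorelSpace E] [Nonempty E] [MeasurableEq X]
    {V₁ V₂ : Measure E} [IsFiniteMeasure V₁] [IsFiniteMeasure V₂] {f : E → X} (hf : Measurable f)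
    (h : V₁.map f = V₂.map f) :
    ∃ G : Measure (E × E), G.map Prod.fst = V₁ ∧ G.map Prod.snd = V₂ ∧
      ∀ᵐ q ∂G, f q.1 = f q.2 := by
  have key : ∀ (V : Measure E) [IsFiniteMeasure V],
      condDistrib id f V ∘ₘ V.map f = V ∧
        ∀ᵐ z ∂V.map f, ∀ᵐ e ∂condDistrib id f V z, f e = z := by
    intro V _
    have hc : V.map f ⊗ₘ condDistrib id f V = V.map fun e => (f e, e) :=
      compProd_map_condDistrib aemeasurable_id
    refine ⟨by rw [condDistrib_comp_map hf.aemeasurable aemeasurable_id, Measure.map_id], ?_⟩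
    refine Measure.ae_ae_of_ae_compProd (p := fun q : X × E => f q.2 = q.1) ?_
    rw [hc, ae_map_iff (by fun_prop) (measurableSet_eq_fun (by fun_prop) (by fun_prop))]
    exact Filter.Eventually.of_forall fun _ => rfl
  obtain ⟨h₁, h₁'⟩ := key V₁
  obtain ⟨h₂, h₂'⟩ := key V₂
  refine ⟨(condDistrib id f V₁ ×ₖ condDistrib id f V₂) ∘ₘ V₁.map f, ?_, ?_, ?_⟩
  · rw [Measure.map_comp _ _ measurable_fst, ← Kernel.fst_eq, Kernel.fst_prod, h₁]
  · rw [Measure.map_comp _ _ measurable_snd, ← Kernel.snd_eq, Kernel.snd_prod, h, h₂]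
  · refine Measure.ae_comp_of_ae_ae (measurableSet_eq_fun (by fun_prop) (by fun_prop)) ?_
    filter_upwards [h₁', h ▸ h₂'] with z hz₁ hz₂
    rw [Kernel.prod_apply]
    filter_upwards [Measure.quasiMeasurePreserving_fst.ae hz₁,
      Measure.quasiMeasurePreserving_snd.ae hz₂] with q hq₁ hq₂
    rw [hq₁, hq₂]

end Gluing

variable {X : Type*} [MeasurableSpace X]

/-- The transition from time `k` to time `k + 1` on trajectories, which resamples the coordinate
`k + 1` given the coordinate `k`. -/
noncomputable def stepKernel (P : ℕ → Kernel X X) (k : ℕ) : Kernel (ℕ → X) (ℕ → X) :=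
  ((P (k + 1)).comap (fun ω : ℕ → X => ω k) (measurable_pi_apply k) ×ₖ Kernel.id).map
    fun p => Function.update p.2 (k + 1) p.1

/-- The synchronous transition on pairs of trajectories, which resamples the coordinate `k + 1` of
both trajectories with the same value, given the coordinate `k` of the first one. -/
noncomputable def syncKernel (P : ℕ → Kernel X X) (k : ℕ) :
    Kernel ((ℕ → X) × (ℕ → X)) ((ℕ → X) × (ℕ → X)) :=
  ((P (k + 1)).comap (fun q : (ℕ → X) × (ℕ → X) => q.1 k) (by fun_prop) ×ₖ Kernel.id).map
    fun p => (Function.update p.2.1 (k + 1) p.1, Function.update p.2.2 (k + 1) p.1)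

/-- The law, on trajectories `ℕ → X` started at `x0`, of the chain run up to time `k` (with the
coordinates after `k` left at the value `x0`). -/
noncomputable def trajLaw (P : ℕ → Kernel X X) (x0 : X) : ℕ → Measure (ℕ → X)
  | 0 => Measure.dirac fun _ => x0
  | k + 1 => stepKernel P k ∘ₘ trajLaw P x0 k

/-- The composite of the first `n` kernels after time `m`. -/
noncomputable def partialBlock (P : ℕ → Kernel X X) (m : ℕ) : ℕ → Kernel X X
  | 0 => Kernel.id
  | n + 1 => P (m + n + 1) ∘ₖ partialBlock P m n

lemma blockKernel_eq_partialBlock (P : ℕ → Kernel X X) (h i : ℕ) :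
    blockKernel P h i = partialBlock P ((i - 1) * h) h := by
  unfold blockKernel
  suffices H : ∀ n, ((List.range n).map fun l => P ((i - 1) * h + l + 1)).foldl
      (fun acc κ => κ ∘ₖ acc) Kernel.id = partialBlock P ((i - 1) * h) n from H h
  intro n
  induction n with
  | zero => rfl
  | succ n ih => rw [List.range_succ, List.map_append, List.foldl_append, ih]; rfl

lemma measurable_update_prod (n : ℕ) :
    Measurable fun p : X × (ℕ → X) => Function.update p.2 n p.1 := by
  refine measurable_pi_lambda _ fun i => ?_
  by_cases hi : i = n
  · subst hi; simpa using measurable_fst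
  · simpa [hi, Function.comp_def] using (measurable_pi_apply i).comp measurable_snd

section Step

variable (P : ℕ → Kernel X X) [∀ i, IsMarkovKernel (P i)] (k : ℕ)

lemma stepKernel_apply (ω : ℕ → X) :
    stepKernel P k ω = (P (k + 1) (ω k)).map fun z => Function.update ω (k + 1) z := by
  rw [stepKernel, Kernel.map_apply _ (measurable_update_prod _), Kernel.prod_apply,
    Kernel.comap_apply, Kernel.id_apply, Measure.prod_dirac,
    Measure.map_map (measurable_update_prod _) (by fun_prop)]
  rfl

instance : IsMarkovKernel (stepKernel P k) :=
  Kernel.IsMarkovKernel.map _ (measurable_update_prod _)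

lemma measurable_update_pair (n : ℕ) : Measurable fun p : X × ((ℕ → X) × (ℕ → X)) =>
    (Function.update p.2.1 n p.1, Function.update p.2.2 n p.1) :=
  ((measurable_update_prod n).comp (measurable_fst.prodMk measurable_snd.fst)).prodMk
    ((measurable_update_prod n).comp (measurable_fst.prodMk measurable_snd.snd))

lemma syncKernel_apply (q : (ℕ → X) × (ℕ → X)) :
    syncKernel P k q = (P (k + 1) (q.1 k)).map fun z =>
      (Function.update q.1 (k + 1) z, Function.update q.2 (k + 1) z) := by
  rw [syncKernel, Kernel.map_apply _ (measurable_update_pair _), Kernel.prod_apply,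
    Kernel.comap_apply, Kernel.id_apply, Measure.prod_dirac,
    Measure.map_map (measurable_update_pair _) (by fun_prop)]
  rfl

lemma measurable_update_pair_right (n : ℕ) (q : (ℕ → X) × (ℕ → X)) :
    Measurable fun z : X => (Function.update q.1 n z, Function.update q.2 n z) :=
  (measurable_update _).prodMk (measurable_update _)

lemma map_fst_syncKernel_comp (C : Measure ((ℕ → X) × (ℕ → X))) :
    (syncKernel P k ∘ₘ C).map Prod.fst = stepKernel P k ∘ₘ C.map Prod.fst := by
  rw [Measure.map_comp _ _ measurable_fst, ← Measure.deterministic_comp_eq_map measurable_fst,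
    Measure.comp_assoc, Kernel.comp_deterministic_eq_comap]
  congr 1
  ext1 q
  rw [Kernel.map_apply _ measurable_fst, syncKernel_apply, Kernel.comap_apply, stepKernel_apply,
    Measure.map_map measurable_fst (measurable_update_pair_right _ _)]
  rfl

lemma map_snd_syncKernel_comp {C : Measure ((ℕ → X) × (ℕ → X))}
    (hC : ∀ᵐ q ∂C, q.1 k = q.2 k) :
    (syncKernel P k ∘ₘ C).map Prod.snd = stepKernel P k ∘ₘ C.map Prod.snd := by
  rw [Measure.map_comp _ _ measurable_snd, ← Measure.deterministic_comp_eq_map measurable_snd,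
    Measure.comp_assoc, Kernel.comp_deterministic_eq_comap]
  refine Measure.comp_congr ?_
  filter_upwards [hC] with q hq
  rw [Kernel.map_apply _ measurable_snd, syncKernel_apply, Kernel.comap_apply, stepKernel_apply,
    Measure.map_map measurable_snd (measurable_update_pair_right _ _), hq]
  rfl

lemma map_eval_stepKernel_comp (U : Measure (ℕ → X)) :
    (stepKernel P k ∘ₘ U).map (fun ω => ω (k + 1)) = P (k + 1) ∘ₘ U.map fun ω => ω k := by
  rw [Measure.map_comp _ _ (measurable_pi_apply _),
    ← Measure.deterministic_comp_eq_map (measurable_pi_apply k),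
    Measure.comp_assoc, Kernel.comp_deterministic_eq_comap]
  congr 1
  ext1 ω
  rw [Kernel.map_apply _ (measurable_pi_apply _), stepKernel_apply, Kernel.comap_apply,
    Measure.map_map (measurable_pi_apply _) (measurable_update _)]
  simp [Function.comp_def]

lemma ae_syncKernel_comp_agree [MeasurableEq X] (C : Measure ((ℕ → X) × (ℕ → X))) :
    ∀ᵐ q ∂syncKernel P k ∘ₘ C, q.1 (k + 1) = q.2 (k + 1) := by
  have hm : MeasurableSet {q : (ℕ → X) × (ℕ → X) | q.1 (k + 1) = q.2 (k + 1)} :=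
    measurableSet_eq_fun (by fun_prop) (by fun_prop)
  refine Measure.ae_comp_of_ae_ae hm (Filter.Eventually.of_forall fun q => ?_)
  rw [syncKernel_apply, ae_map_iff (measurable_update_pair_right _ _).aemeasurable hm]
  simp

lemma measurableSet_ne {ι : Type*} [MeasurableEq X] (i : ι) :
    MeasurableSet {q : (ι → X) × (ι → X) | q.1 i ≠ q.2 i} :=
  (measurableSet_eq_fun (by fun_prop) (by fun_prop)).compl

lemma syncKernel_comp_apply_ne [MeasurableEq X] (C : Measure ((ℕ → X) × (ℕ → X))) {i : ℕ}
    (hi : i ≤ k) :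
    (syncKernel P k ∘ₘ C) {q | q.1 i ≠ q.2 i} = C {q | q.1 i ≠ q.2 i} := by
  have hm := measurableSet_ne (X := X) i
  have hik : i ≠ k + 1 := by omega
  rw [Measure.bind_apply hm (Kernel.aemeasurable _), ← lintegral_indicator_one hm]
  refine lintegral_congr fun q => ?_
  rw [syncKernel_apply, Measure.map_apply (measurable_update_pair_right _ _) hm]
  by_cases hq : q.1 i = q.2 i <;> simp [hik, hq]

end Step

section Law

variable (P : ℕ → Kernel X X) [∀ i, IsMarkovKernel (P i)] (x0 : X)

instance (k : ℕ) : IsProbabilityMeasure (trajLaw P x0 k) := by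
  induction k with
  | zero => exact Measure.dirac.isProbabilityMeasure
  | succ k ih => rw [trajLaw]; infer_instance

lemma ae_trajLaw_zero [MeasurableEq X] (k : ℕ) :
    ∀ᵐ ω ∂trajLaw P x0 k, ω 0 = x0 := by
  have hm : MeasurableSet {ω : ℕ → X | ω 0 = x0} :=
    measurableSet_eq_fun (by fun_prop) measurable_const
  induction k with
  | zero => rw [trajLaw, ae_dirac_iff hm]
  | succ k ih =>
    refine Measure.ae_comp_of_ae_ae hm (ih.mono fun ω hω => ?_)
    rw [stepKernel_apply, ae_map_iff (measurable_update _).aemeasurable hm]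
    simp [hω]

lemma measurable_snoc_prod (k : ℕ) :
    Measurable fun p : X × (Fin k → X) => (Fin.snoc p.2 p.1 : Fin (k + 1) → X) := by
  refine measurable_pi_lambda _ fun i => ?_
  refine Fin.lastCases ?_ (fun j => ?_) i
  · simpa using measurable_fst
  · simpa [Function.comp_def] using (measurable_pi_apply j).comp measurable_snd

lemma measurable_chainLaw_step (k : ℕ) :
    Measurable fun xs : Fin k → X =>
      (P (k + 1) (if hk : k = 0 then x0 else xs ⟨k - 1, by omega⟩)).map
        (Fin.snoc (α := fun _ => X) xs) := by
  have hlast : Measurable fun xs : Fin k → X =>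
      if hk : k = 0 then x0 else xs ⟨k - 1, by omega⟩ := by
    by_cases hk : k = 0
    · simp [hk]
    · simpa [hk] using measurable_pi_apply _
  convert (((P (k + 1)).comap _ hlast ×ₖ Kernel.id).map
    fun p : X × (Fin k → X) => (Fin.snoc p.2 p.1 : Fin (k + 1) → X)).measurable using 2 with xs
  rw [Kernel.map_apply _ (measurable_snoc_prod _), Kernel.prod_apply,
    Kernel.comap_apply, Kernel.id_apply, Measure.prod_dirac,
    Measure.map_map (measurable_snoc_prod _) (by fun_prop)]
  rfl

lemma chainLaw_eq_map_trajLaw [MeasurableEq X] (k : ℕ) :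
    chainLaw P x0 k = (trajLaw P x0 k).map fun ω (i : Fin k) => ω (i + 1) := by
  induction k with
  | zero =>
    rw [chainLaw, trajLaw,
      Measure.map_dirac' (f := fun (ω : ℕ → X) (i : Fin 0) => ω (i + 1)) (by fun_prop)]
    congr 1
    exact Subsingleton.elim _ _
  | succ k ih =>
    have hg : Measurable fun (ω : ℕ → X) (i : Fin k) => ω (i + 1) := by fun_prop
    rw [chainLaw, ih, trajLaw, Measure.map_comp _ _ (by fun_prop), Measure.bind,
      Measure.map_map (measurable_chainLaw_step P x0 k) hg]
    refine Measure.bind_congr_right ?_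
    filter_upwards [ae_trajLaw_zero P x0 k] with ω hω
    rw [Kernel.map_apply _ (by fun_prop), stepKernel_apply,
      Measure.map_map (by fun_prop) (measurable_update _)]
    have hstate : (if hk : k = 0 then x0 else ω ((⟨k - 1, by omega⟩ : Fin k) + 1)) = ω k := by
      split_ifs with hk
      · rw [hk, hω]
      · congr 1
        simp only
        omega
    simp only [Function.comp_apply, hstate]
    congr 1
    ext z i
    refine Fin.lastCases ?_ (fun j => ?_) i
    · simp
    · have : (j : ℕ) ≠ k := j.2.ne
      simp [this]

end Law

section PartialCoupling

/-- A coupling in progress of `μ₁` and `μ₂` at time `k`: a coupled part `C`, whose trajectories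
agree at time `k`, and two uncoupled remainders of mass `u`. At every time `i < k`, the coupled
trajectories that disagree, together with the whole uncoupled part, have mass at most `b i`. -/
structure IsPartialCoupling (b : ℕ → ℝ≥0∞) (μ₁ μ₂ : Measure (ℕ → X)) (k : ℕ) (u : ℝ≥0∞)
    (C : Measure ((ℕ → X) × (ℕ → X))) (U₁ U₂ : Measure (ℕ → X)) : Prop where
  map_fst : C.map Prod.fst + U₁ = μ₁
  map_snd : C.map Prod.snd + U₂ = μ₂
  agree : ∀ᵐ q ∂C, q.1 k = q.2 k
  mass_left : U₁ Set.univ = u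
  mass_right : U₂ Set.univ = u
  bound : ∀ i < k, C {q | q.1 i ≠ q.2 i} + u ≤ b i

variable {b : ℕ → ℝ≥0∞} {μ₁ μ₂ : Measure (ℕ → X)} {k : ℕ} {u : ℝ≥0∞}
  {C : Measure ((ℕ → X) × (ℕ → X))} {U₁ U₂ : Measure (ℕ → X)}

lemma IsPartialCoupling.step [MeasurableEq X] (P : ℕ → Kernel X X) [∀ i, IsMarkovKernel (P i)]
    (H : IsPartialCoupling b μ₁ μ₂ k u C U₁ U₂) (hu : u ≤ b k) :
    IsPartialCoupling b (stepKernel P k ∘ₘ μ₁) (stepKernel P k ∘ₘ μ₂) (k + 1) u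
      (syncKernel P k ∘ₘ C) (stepKernel P k ∘ₘ U₁) (stepKernel P k ∘ₘ U₂) where
  map_fst := by rw [map_fst_syncKernel_comp, ← Measure.comp_add, H.map_fst]
  map_snd := by rw [map_snd_syncKernel_comp P k H.agree, ← Measure.comp_add, H.map_snd]
  agree := ae_syncKernel_comp_agree P k C
  mass_left := by rw [Measure.comp_apply_univ, H.mass_left]
  mass_right := by rw [Measure.comp_apply_univ, H.mass_right]
  bound i hi := by
    rw [syncKernel_comp_apply_ne P k C (by omega)]
    rcases Nat.lt_succ_iff_lt_or_eq.1 hi with hi | rfl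
    · exact H.bound i hi
    · rwa [ae_iff.1 H.agree, zero_add]

/-- If both remainders charge a common measure `ρ` at time `k`, that part of them can be coupled. -/
lemma IsPartialCoupling.merge [StandardBorelSpace X] [Nonempty X]
    (H : IsPartialCoupling b μ₁ μ₂ k u C U₁ U₂) (hu : u ≠ ∞) {ρ : Measure X}
    (h₁ : ρ ≤ U₁.map fun ω => ω k) (h₂ : ρ ≤ U₂.map fun ω => ω k) :
    ∃ C' U₁' U₂', IsPartialCoupling b μ₁ μ₂ k (u - ρ Set.univ) C' U₁' U₂' := by
  have : IsFiniteMeasure U₁ := ⟨by rw [H.mass_left]; exact hu.lt_top⟩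
  have : IsFiniteMeasure U₂ := ⟨by rw [H.mass_right]; exact hu.lt_top⟩
  have hk : Measurable fun ω : ℕ → X => ω k := measurable_pi_apply k
  obtain ⟨V₁, W₁, hVW₁, hV₁⟩ := exists_add_eq_of_le_map hk h₁
  obtain ⟨V₂, W₂, hVW₂, hV₂⟩ := exists_add_eq_of_le_map hk h₂
  have : IsFiniteMeasure V₁ := isFiniteMeasure_of_le U₁ (hVW₁ ▸ Measure.le_add_right le_rfl)
  have : IsFiniteMeasure V₂ := isFiniteMeasure_of_le U₂ (hVW₂ ▸ Measure.le_add_right le_rfl)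
  obtain ⟨G, hG₁, hG₂, hG⟩ := exists_coupling_of_map_eq hk (hV₁.trans hV₂.symm)
  have hV₁u : V₁ Set.univ = ρ Set.univ := by
    rw [← hV₁, Measure.map_apply hk MeasurableSet.univ, Set.preimage_univ]
  have hV₂u : V₂ Set.univ = ρ Set.univ := by
    rw [← hV₂, Measure.map_apply hk MeasurableSet.univ, Set.preimage_univ]
  have hGu : G Set.univ = ρ Set.univ := by
    rw [← hV₁u, ← hG₁, Measure.map_apply measurable_fst MeasurableSet.univ, Set.preimage_univ]
  have hm₁ : ρ Set.univ + W₁ Set.univ = u := by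
    rw [← H.mass_left, ← hVW₁, Measure.add_apply, hV₁u]
  have hm₂ : ρ Set.univ + W₂ Set.univ = u := by
    rw [← H.mass_right, ← hVW₂, Measure.add_apply, hV₂u]
  have hρu : ρ Set.univ ≤ u := hm₁ ▸ le_self_add
  have hρ : ρ Set.univ ≠ ∞ := ne_top_of_le_ne_top hu hρu
  refine ⟨C + G, W₁, W₂, ?_, ?_, ?_, ?_, ?_, fun i hi => ?_⟩
  · rw [Measure.map_add _ _ measurable_fst, hG₁, add_assoc, hVW₁, H.map_fst]
  · rw [Measure.map_add _ _ measurable_snd, hG₂, add_assoc, hVW₂, H.map_snd]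
  · rw [ae_add_measure_iff]
    exact ⟨H.agree, hG⟩
  · rw [← hm₁, ENNReal.add_sub_cancel_left hρ]
  · rw [← hm₂, ENNReal.add_sub_cancel_left hρ]
  · refine le_trans ?_ (H.bound i hi)
    rw [Measure.add_apply, add_assoc]
    gcongr
    calc G {q | q.1 i ≠ q.2 i} + (u - ρ Set.univ) ≤ ρ Set.univ + (u - ρ Set.univ) := by
          gcongr
          exact hGu ▸ measure_mono (Set.subset_univ _)
      _ = u := add_tsub_cancel_of_le hρu

/-- Coupling the two remainders independently completes a partial coupling. -/
lemma IsPartialCoupling.exists_coupling (H : IsPartialCoupling b μ₁ μ₂ k u C U₁ U₂) (hu : u ≠ ∞)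
    (hb : u ≤ b k) :
    ∃ Ψ : Measure ((ℕ → X) × (ℕ → X)), Ψ.map Prod.fst = μ₁ ∧ Ψ.map Prod.snd = μ₂ ∧
      ∀ i ≤ k, Ψ {q | q.1 i ≠ q.2 i} ≤ b i := by
  have : IsFiniteMeasure U₁ := ⟨by rw [H.mass_left]; exact hu.lt_top⟩
  have : IsFiniteMeasure U₂ := ⟨by rw [H.mass_right]; exact hu.lt_top⟩
  have hsmul : ∀ U : Measure (ℕ → X), U Set.univ = u → u⁻¹ • u • U = U := by
    intro U hU
    rcases eq_or_ne u 0 with rfl | h0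
    · simp [Measure.measure_univ_eq_zero.1 hU]
    · rw [smul_smul, ENNReal.inv_mul_cancel h0 hu, one_smul]
  refine ⟨C + u⁻¹ • U₁.prod U₂, ?_, ?_, fun i hi => ?_⟩
  · rw [Measure.map_add _ _ measurable_fst, Measure.map_smul, Measure.map_fst_prod, H.mass_right,
      hsmul U₁ H.mass_left, H.map_fst]
  · rw [Measure.map_add _ _ measurable_snd, Measure.map_smul, Measure.map_snd_prod, H.mass_left,
      hsmul U₂ H.mass_right, H.map_snd]
  · have hprod : (u⁻¹ • U₁.prod U₂) {q | q.1 i ≠ q.2 i} ≤ u := by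
      refine (measure_mono (Set.subset_univ _)).trans ?_
      rw [Measure.smul_apply, ← Set.univ_prod_univ, Measure.prod_prod, H.mass_left, H.mass_right,
        smul_eq_mul, ← mul_assoc]
      exact (mul_le_mul_left (ENNReal.inv_mul_le_one u) u).trans_eq (one_mul u)
    rw [Measure.add_apply]
    rcases hi.lt_or_eq with hi | rfl
    · exact (add_le_add_right hprod _).trans (H.bound i hi)
    · rw [ae_iff.1 H.agree, zero_add]
      exact hprod.trans hb

end PartialCoupling

lemma smul_le_comp_of_minorization {κ : Kernel X X} {ν : Measure X} {a : ℝ≥0∞}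
    (h : ∀ x A, MeasurableSet A → a * ν A ≤ κ x A) (μ : Measure X) :
    (a * μ Set.univ) • ν ≤ κ ∘ₘ μ := by
  refine Measure.le_iff.2 fun A hA => ?_
  rw [Measure.bind_apply hA κ.aemeasurable, Measure.smul_apply, smul_eq_mul, mul_right_comm,
    ← lintegral_const]
  exact lintegral_mono fun x => h x A hA

section Blocks

variable (P : ℕ → Kernel X X) [∀ i, IsMarkovKernel (P i)] {h : ℕ} (x0 y0 : X)

lemma exists_isPartialCoupling_add [MeasurableEq X] {β : ℝ≥0∞} {j : ℕ}
    {C : Measure ((ℕ → X) × (ℕ → X))} {U₁ U₂ : Measure (ℕ → X)}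
    (H : IsPartialCoupling (fun i => β ^ (i / h)) (trajLaw P x0 (j * h)) (trajLaw P y0 (j * h))
      (j * h) (β ^ j) C U₁ U₂) :
    ∀ n ≤ h, ∃ C' U₁' U₂', IsPartialCoupling (fun i => β ^ (i / h)) (trajLaw P x0 (j * h + n))
        (trajLaw P y0 (j * h + n)) (j * h + n) (β ^ j) C' U₁' U₂' ∧
      U₁'.map (fun ω => ω (j * h + n)) =
        partialBlock P (j * h) n ∘ₘ U₁.map (fun ω => ω (j * h)) ∧
      U₂'.map (fun ω => ω (j * h + n)) =
        partialBlock P (j * h) n ∘ₘ U₂.map fun ω => ω (j * h) := by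
  intro n
  induction n with
  | zero => exact fun _ => ⟨C, U₁, U₂, H, Measure.id_comp.symm, Measure.id_comp.symm⟩
  | succ n ih =>
    intro hn
    obtain ⟨C', U₁', U₂', H', e₁, e₂⟩ := ih (by omega)
    have hdiv : (j * h + n) / h = j := by
      rw [mul_comm, Nat.mul_add_div (by omega), Nat.div_eq_of_lt (by omega), add_zero]
    refine ⟨_, _, _, H'.step P (by rw [hdiv]), ?_, ?_⟩
    · rw [partialBlock, ← Measure.comp_assoc, ← e₁]
      exact map_eval_stepKernel_comp P _ _
    · rw [partialBlock, ← Measure.comp_assoc, ← e₂]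
      exact map_eval_stepKernel_comp P _ _

lemma exists_isPartialCoupling_mul [StandardBorelSpace X] {a : ℝ≥0∞} {m : ℕ} {ν : ℕ → Measure X}
    [∀ i, IsProbabilityMeasure (ν i)]
    (hminor : ∀ i ∈ Finset.Icc 1 m, ∀ x A, MeasurableSet A → a * ν i A ≤ blockKernel P h i x A) :
    ∀ j ≤ m, ∃ C U₁ U₂, IsPartialCoupling (fun i => (1 - a) ^ (i / h)) (trajLaw P x0 (j * h))
      (trajLaw P y0 (j * h)) (j * h) ((1 - a) ^ j) C U₁ U₂ := by
  have : Nonempty X := ⟨x0⟩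
  have hpow : ∀ j, (1 - a) ^ j ≠ ∞ := fun j =>
    ENNReal.pow_ne_top (ne_top_of_le_ne_top ENNReal.one_ne_top tsub_le_self)
  intro j
  induction j with
  | zero =>
    refine fun _ => ⟨0, trajLaw P x0 (0 * h), trajLaw P y0 (0 * h), ?_, ?_, ?_, ?_, ?_, ?_⟩ <;>
      simp
  | succ j ih =>
    intro hj
    obtain ⟨C, U₁, U₂, H⟩ := ih (by omega)
    obtain ⟨C', U₁', U₂', H', e₁, e₂⟩ := exists_isPartialCoupling_add P x0 y0 H h le_rfl
    have hblock : partialBlock P (j * h) h = blockKernel P h (j + 1) := by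
      rw [blockKernel_eq_partialBlock, Nat.add_sub_cancel]
    have hle : ∀ U : Measure (ℕ → X), U Set.univ = (1 - a) ^ j →
        (a * (1 - a) ^ j) • ν (j + 1) ≤
          partialBlock P (j * h) h ∘ₘ U.map fun ω => ω (j * h) := by
      intro U hU
      have := smul_le_comp_of_minorization (hminor (j + 1) (Finset.mem_Icc.2 ⟨by omega, hj⟩))
        (U.map fun ω => ω (j * h))
      rwa [Measure.map_apply (measurable_pi_apply _) MeasurableSet.univ, Set.preimage_univ, hU,
        ← hblock] at this
    obtain ⟨C'', U₁'', U₂'', H''⟩ := H'.merge (hpow j) (e₁ ▸ hle U₁ H.mass_left)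
      (e₂ ▸ hle U₂ H.mass_right)
    refine ⟨C'', U₁'', U₂'', ?_⟩
    rw [Measure.smul_apply, measure_univ, smul_eq_mul, mul_one] at H''
    rwa [pow_succ', ENNReal.sub_mul fun _ _ => hpow j, one_mul, add_mul, one_mul]

end Blocks

end MarkovCoupling

theorem stmt14 {X : Type*} [MeasurableSpace X] [StandardBorelSpace X]
    (t h : ℕ) (ht : 1 ≤ t) (hh : 1 ≤ h)
    (P : ℕ → Kernel X X) (hP : ∀ i, IsMarkovKernel (P i))
    (ν : ℕ → Measure X) (hν : ∀ i, IsProbabilityMeasure (ν i))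
    (α : ℝ) (hα0 : 0 ≤ α) (hα1 : α ≤ 1)
    (hminor : ∀ i ∈ Finset.Icc 1 (t / h), ∀ x : X, ∀ A : Set X, MeasurableSet A →
      ENNReal.ofReal α * ν i A ≤ blockKernel P h i x A)
    (x0 y0 : X) :
    ∃ Ψ : Measure ((Fin t → X) × (Fin t → X)), IsProbabilityMeasure Ψ ∧
      Ψ.map Prod.fst = chainLaw P x0 t ∧ Ψ.map Prod.snd = chainLaw P y0 t ∧
      ∀ i : Fin t, (Ψ {q | q.1 i ≠ q.2 i}).toReal ≤ (1 - α) ^ (((i : ℕ) + 1) / h) := by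
  have ha_top : 1 - ENNReal.ofReal α ≠ ⊤ := ne_top_of_le_ne_top ENNReal.one_ne_top tsub_le_self
  have hdiv : (t / h * h + t % h) / h = t / h := by rw [Nat.div_add_mod']
  obtain ⟨C, U₁, U₂, H⟩ :=
    MarkovCoupling.exists_isPartialCoupling_mul P x0 y0 hminor (t / h) le_rfl
  obtain ⟨C', U₁', U₂', H', -, -⟩ :=
    MarkovCoupling.exists_isPartialCoupling_add P x0 y0 H (t % h) (Nat.mod_lt _ hh).le
  obtain ⟨Ψ, h₁, h₂, hΨ⟩ := H'.exists_coupling (ENNReal.pow_ne_top ha_top) (by rw [hdiv])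
  rw [Nat.div_add_mod'] at h₁ h₂ hΨ
  have hπ : Measurable fun (ω : ℕ → X) (i : Fin t) => ω (i + 1) := by fun_prop
  have hΨprob : IsProbabilityMeasure Ψ := by
    refine ⟨?_⟩
    rw [← Set.preimage_univ (f := Prod.fst),
      ← Measure.map_apply measurable_fst MeasurableSet.univ, h₁, measure_univ]
  refine ⟨Ψ.map (Prod.map (fun ω i => ω (i + 1)) fun ω i => ω (i + 1)),
    Measure.isProbabilityMeasure_map (hπ.prodMap hπ).aemeasurable, ?_, ?_, fun i => ?_⟩
  · rw [MarkovCoupling.chainLaw_eq_map_trajLaw, ← h₁, Measure.map_map hπ measurable_fst,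
      Measure.map_map measurable_fst (hπ.prodMap hπ)]
    rfl
  · rw [MarkovCoupling.chainLaw_eq_map_trajLaw, ← h₂, Measure.map_map hπ measurable_snd,
      Measure.map_map measurable_snd (hπ.prodMap hπ)]
    rfl
  · refine ENNReal.toReal_le_of_le_ofReal (by have := sub_nonneg.2 hα1; positivity) ?_
    rw [Measure.map_apply (hπ.prodMap hπ) (MarkovCoupling.measurableSet_ne i),
      ENNReal.ofReal_pow (sub_nonneg.2 hα1), ENNReal.ofReal_sub _ hα0, ENNReal.ofReal_one]
    exact hΨ (i + 1) (by omega)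
end
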